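/- arXiv:2410.06897 — 2 statements merged into one kernel-verified Lean document; each statement's English description precedes it below -/
import Mathlib

section
/- Let n ≥ 1, 0 < R < 1, r := R/2, B_r := {x ∈ ℝⁿ : |x| < r}, and τ(x) := (r² − |x|²)²/4. Let a : B_r → ℝ^{n×n}, b : B_r → ℝⁿ, c : B_r → ℝ, ρ : B_r → ℝ satisfy, for constants 0 < c₀ ≤ C₀, b₀ ≥ 0, ε₀ > 0: c₀|ξ|² ≤ Σ_{κ,l} a_{κl}(x) ξ_κ ξ_l ≤ C₀|ξ|² for all ξ ∈ ℝⁿ, |b(x)| ≤ b₀, |c(x)| ≤ b₀, and ρ(x) ≥ ε₀, for all x ∈ B_r. Let α > 0 and define A := (2^{4α−1}/(ε₀ c₀^{2α−1})) (4nC₀ + (9/4)b₀)(4nC₀ + (9/4)b₀ + 2c₀)^{2α−1} if α ≥ 1/2, and A := (2^{6α−2}/ε₀)(4nC₀ + (9/4)b₀) if α < 1/2. Then for every x ∈ B_r, −( Σ_{κ,l} a_{κl}(x) ∂²τ/∂x_κ∂x_l(x) + Σ_l b_l(x) ∂τ/∂x_l(x) + c(x) τ(x) ) ≤ (A / R^{4α−2})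 ρ(x) τ(x)^α. -/
open MeasureTheory Metric Finset
open scoped ENNReal NNReal

noncomputable section

/-- Euclidean space `ℝⁿ`. -/
abbrev Esp (n : ℕ) := EuclideanSpace ℝ (Fin n)

/-- First partial derivative `∂u/∂x_l`. -/
noncomputable def pderiv1 {n : ℕ} (u : Esp n → ℝ) (l : Fin n) (x : Esp n) : ℝ :=
  fderiv ℝ u x (EuclideanSpace.single l 1)

/-- Second partial derivative `∂²u/∂x_κ∂x_l`. -/
noncomputable def pderiv2 {n : ℕ} (u : Esp n → ℝ) (κ l : Fin n) (x : Esp n) : ℝ :=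
  fderiv ℝ (fun y => fderiv ℝ u y (EuclideanSpace.single l 1)) x (EuclideanSpace.single κ 1)

/-- The nondivergence form operator `L u = Σ a_{κl} ∂_{κl} u + Σ b_l ∂_l u + c u`. -/
noncomputable def Lop {n : ℕ} (a : Esp n → Fin n → Fin n → ℝ) (b : Esp n → Fin n → ℝ)
    (c : Esp n → ℝ) (u : Esp n → ℝ) (x : Esp n) : ℝ :=
  (∑ κ, ∑ l, a x κ l * pderiv2 u κ l x) + (∑ l, b x l * pderiv1 u l x) + c x * u x

/-- `u` is twice continuously differentiable in `Ω` with bounded second derivatives and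
continuously differentiable on the closure of `Ω`. -/
def Regular {n : ℕ} (Ω : Set (Esp n)) (u : Esp n → ℝ) : Prop :=
  ContDiffOn ℝ 2 u Ω ∧ ContDiffOn ℝ 1 u (closure Ω) ∧
    ∃ K : ℝ, ∀ x ∈ Ω, ∀ κ l : Fin n, |pderiv2 u κ l x| ≤ K

/-- The bounds on the coefficients of the operators: uniform ellipticity with constants
`c₀ ≤ C₀` and bound `b₀` on the lower order coefficients. -/
def CoeffBounds {n : ℕ} (Ω : Set (Esp n)) (a : Esp n → Fin n → Fin n → ℝ)
    (b : Esp n → Fin n → ℝ) (c : Esp n → ℝ) (c₀ C₀ b₀ : ℝ) : Prop :=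
  (∀ x ∈ Ω, ∀ ξ : Fin n → ℝ,
      c₀ * ∑ l, ξ l ^ 2 ≤ ∑ κ, ∑ l, a x κ l * ξ κ * ξ l ∧
      ∑ κ, ∑ l, a x κ l * ξ κ * ξ l ≤ C₀ * ∑ l, ξ l ^ 2) ∧
  (∀ x ∈ Ω, Real.sqrt (∑ l, b x l ^ 2) ≤ b₀) ∧ (∀ x ∈ Ω, |c x| ≤ b₀)

/-- `‖b‖_∞ = sup_{x ∈ Ω} (Σ_l b_l(x)²)^{1/2}`. -/
noncomputable def bSup {n : ℕ} (Ω : Set (Esp n)) (b : Esp n → Fin n → ℝ) : ℝ :=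
  ⨆ x : Ω, Real.sqrt (∑ l, b (x : Esp n) l ^ 2)

/-- `inf_Ω c`. -/
noncomputable def cInf {n : ℕ} (Ω : Set (Esp n)) (c : Esp n → ℝ) : ℝ :=
  ⨅ x : Ω, c (x : Esp n)

/-- The Lebesgue measure of a set, as a real number. -/
noncomputable def mvol {n : ℕ} (s : Set (Esp n)) : ℝ := (volume s).toReal

/-- The first Dirichlet eigenvalue `Σ = λ₁(-Δ, B₁)` of the unit ball, as the infimum of the
Rayleigh quotient over nonzero smooth compactly supported functions in `B₁`. -/
noncomputable def Sig (n : ℕ) : ℝ :=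
  sInf { q : ℝ | ∃ u : Esp n → ℝ, ContDiff ℝ (⊤ : ℕ∞) u ∧ HasCompactSupport u ∧
    tsupport u ⊆ ball (0 : Esp n) 1 ∧ u ≠ 0 ∧
    q = (∫ x in ball (0 : Esp n) 1, ‖fderiv ℝ u x‖ ^ 2) /
        (∫ x in ball (0 : Esp n) 1, u x ^ 2) }

/-- `L^p(Ω)` norm of a function. -/
noncomputable def LpNormOn {n : ℕ} (Ω : Set (Esp n)) (ρ : Esp n → ℝ) (p : ℝ≥0∞) : ℝ :=
  (eLpNorm ρ p (volume.restrict Ω)).toReal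

/-- `Λ` is a principal eigenvalue of the generalized Lane–Emden system
`-L_i u_i = Λ_i ρ_i u_{i+1}^{α_i}` in `Ω`, `u = 0` on `∂Ω`. -/
def IsPrincipalEV {n m : ℕ} [NeZero m] (Ω : Set (Esp n))
    (a : Fin m → Esp n → Fin n → Fin n → ℝ) (b : Fin m → Esp n → Fin n → ℝ)
    (c : Fin m → Esp n → ℝ) (ρ : Fin m → Esp n → ℝ) (α : Fin m → ℝ)
    (Λ : Fin m → ℝ) : Prop :=
  ∃ φ : Fin m → Esp n → ℝ,
    (∀ i, Regular Ω (φ i)) ∧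
    (∀ i, ∀ x ∈ frontier Ω, φ i x = 0) ∧
    (∀ i, ∀ x ∈ Ω, 0 < φ i x) ∧
    ∀ i, ∀ᵐ x ∂(volume.restrict Ω),
      -Lop (a i) (b i) (c i) (φ i) x = Λ i * ρ i x * φ (i + 1) x ^ α i

/-- `H(Λ) = λ₁ λ₂^{α₁} λ₃^{α₁α₂} ⋯ λ_m^{α₁⋯α_{m-1}}`. -/
noncomputable def Hfun {m : ℕ} (α Λ : Fin m → ℝ) : ℝ :=
  ∏ i, Λ i ^ (∏ j ∈ Finset.Iio i, α j)

/-- The Laplacian. -/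
noncomputable def lapl {n : ℕ} (u : Esp n → ℝ) (x : Esp n) : ℝ := ∑ l, pderiv2 u l l x

/-- `lam` is a principal eigenvalue of the Navier problem `(-Δ)^m v = lam ρ v` in `Ω`,
`v = (-Δ)^j v = 0` on `∂Ω`:  `v j` plays the role of `(-Δ)^j v`. -/
def IsNavierPrincipalEV {n : ℕ} (m : ℕ) [NeZero m] (Ω : Set (Esp n)) (ρ : Esp n → ℝ)
    (lam : ℝ) : Prop :=
  ∃ v : Fin m → Esp n → ℝ,
    (∀ j, Regular Ω (v j)) ∧
    (∀ j, ∀ x ∈ frontier Ω, v j x = 0) ∧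
    (∀ j, ∀ x ∈ Ω, 0 < v j x) ∧
    (∀ j : Fin m, (j : ℕ) + 1 < m → ∀ x ∈ Ω, -lapl (v j) x = v (j + 1) x) ∧
    ∀ j : Fin m, (j : ℕ) + 1 = m →
      ∀ᵐ x ∂(volume.restrict Ω), -lapl (v j) x = lam * ρ x * v 0 x


/-- The gradient of the barrier `(r² - |x|²)²/4` is `-(r² - |x|²) x`. -/
theorem hasFDerivAt_barrier {E : Type*} [NormedAddCommGroup E] [InnerProductSpace ℝ E]
    (r : ℝ) (x : E) :
    HasFDerivAt (fun y : E => (r ^ 2 - ‖y‖ ^ 2) ^ 2 / 4)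
      (-(r ^ 2 - ‖x‖ ^ 2) • innerSL ℝ x) x := by
  have h := ((((hasStrictFDerivAt_norm_sq x).hasFDerivAt).const_sub (r ^ 2)).pow 2).mul_const
    (1 / 4 : ℝ)
  refine (h.congr_fderiv ?_).congr_of_eventuallyEq (.of_forall fun y => ?_)
  · ext v
    simp
    ring
  · simp
    ring

theorem pderiv1_barrier {n : ℕ} (r : ℝ) (l : Fin n) (x : Esp n) :
    pderiv1 (fun y : Esp n => (r ^ 2 - ‖y‖ ^ 2) ^ 2 / 4) l x = -x l * (r ^ 2 - ‖x‖ ^ 2) := by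
  rw [pderiv1, (hasFDerivAt_barrier r x).fderiv]
  simp [EuclideanSpace.inner_single_right]
  ring

theorem pderiv2_barrier {n : ℕ} (r : ℝ) (κ l : Fin n) (x : Esp n) :
    pderiv2 (fun y : Esp n => (r ^ 2 - ‖y‖ ^ 2) ^ 2 / 4) κ l x =
      -(if κ = l then r ^ 2 - ‖x‖ ^ 2 else 0) + 2 * x κ * x l := by
  have hfun : (fun y : Esp n => fderiv ℝ (fun y : Esp n => (r ^ 2 - ‖y‖ ^ 2) ^ 2 / 4) y
      (EuclideanSpace.single l 1)) = fun y => (r ^ 2 - ‖y‖ ^ 2) * -(y l) := by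
    funext y
    have := pderiv1_barrier r l y
    rw [pderiv1] at this
    rw [this]
    ring
  have hcoord : HasFDerivAt (fun y : Esp n => y l)
      (EuclideanSpace.proj l : Esp n →L[ℝ] ℝ) x :=
    (EuclideanSpace.proj l : Esp n →L[ℝ] ℝ).hasFDerivAt
  have h : HasFDerivAt (fun y : Esp n => (r ^ 2 - ‖y‖ ^ 2) * -(y l)) _ x :=
    (((hasStrictFDerivAt_norm_sq x).hasFDerivAt).const_sub (r ^ 2)).mul hcoord.neg
  rw [pderiv2, hfun, h.fderiv]
  by_cases hκ : κ = l
  · subst hκ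
    simp [EuclideanSpace.inner_single_right]
    ring
  · simp [EuclideanSpace.inner_single_right, hκ, Ne.symm hκ]
    ring

/-- The operator applied to the barrier, bounded using ellipticity and the bounds on the
coefficients at a point, with `ξ` the point and `d = r² - |ξ|²`. -/
theorem neg_operator_barrier_le {n : ℕ} (a : Fin n → Fin n → ℝ) (b ξ : Fin n → ℝ)
    (c c₀ C₀ b₀ d : ℝ)
    (hell : ∀ η : Fin n → ℝ, c₀ * ∑ l, η l ^ 2 ≤ ∑ κ, ∑ l, a κ l * η κ * η l ∧
      ∑ κ, ∑ l, a κ l * η κ * η l ≤ C₀ * ∑ l, η l ^ 2)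
    (hb : √(∑ l, b l ^ 2) ≤ b₀) (hc : |c| ≤ b₀)
    (hd : 0 ≤ d) (hd4 : d ≤ 1 / 4) (hξ : √(∑ l, ξ l ^ 2) ≤ 1 / 2) :
    -((∑ κ, ∑ l, a κ l * (-(if κ = l then d else 0) + 2 * ξ κ * ξ l)) +
        (∑ l, b l * (-ξ l * d)) + c * (d ^ 2 / 4)) ≤
      d * ((4 * n * C₀ + 9 / 4 * b₀) / 4) - 2 * c₀ * ∑ l, ξ l ^ 2 := by
  have hb₀ : 0 ≤ b₀ := (abs_nonneg c).trans hc
  have hdiag (l : Fin n) : a l l ≤ C₀ := by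
    simpa [Pi.single_apply, ite_pow] using (hell (Pi.single l 1)).2
  have htr : ∑ l, a l l ≤ n * C₀ := by
    simpa using Finset.sum_le_sum fun l (_ : l ∈ Finset.univ) => hdiag l
  have hsecond : ∑ κ, ∑ l, a κ l * (-(if κ = l then d else 0) + 2 * ξ κ * ξ l) =
      -d * (∑ l, a l l) + 2 * ∑ κ, ∑ l, a κ l * ξ κ * ξ l := by
    simp only [mul_add, Finset.sum_add_distrib, Finset.mul_sum]
    congr 1
    · refine Finset.sum_congr rfl fun κ _ => ?_
      simp [mul_comm]
    · refine Finset.sum_congr rfl fun κ _ => Finset.sum_congr rfl fun l _ => ?_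
      ring
  have hfirst : ∑ l, b l * (-ξ l * d) = -d * ∑ l, b l * ξ l := by
    rw [Finset.mul_sum]
    exact Finset.sum_congr rfl fun l _ => by ring
  have hinner : ∑ l, b l * ξ l ≤ b₀ * (1 / 2) :=
    (Real.sum_mul_le_sqrt_mul_sqrt _ _ _).trans
      (mul_le_mul hb hξ (Real.sqrt_nonneg _) hb₀)
  have hzero : -c * d ≤ b₀ * (1 / 4) :=
    mul_le_mul ((neg_le_abs c).trans hc) hd4 hd hb₀
  rw [hsecond, hfirst]
  nlinarith [(hell ξ).1, mul_le_mul_of_nonneg_left htr hd,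
    mul_le_mul_of_nonneg_left hinner hd, mul_le_mul_of_nonneg_left hzero hd]

theorem rpow_sq_div_four {d : ℝ} (hd : 0 < d) (α : ℝ) :
    (d ^ 2 / 4) ^ α = (d / 2) ^ (2 * α - 1) * (d / 2) := by
  rw [show d ^ 2 / 4 = (d / 2) ^ (2 : ℝ) by rw [Real.rpow_two]; ring,
    ← Real.rpow_mul (by positivity), ← Real.rpow_add_one (by positivity)]
  congr 1
  ring

theorem barrier_constant_mul_of_half_le {R d c₀ K ε₀ : ℝ} (α : ℝ) (hR : 0 < R) (hd : 0 < d)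
    (hc₀ : 0 < c₀) (hK : 0 ≤ K) (hε₀ : 0 < ε₀) :
    (2 : ℝ) ^ (4 * α - 1) / (ε₀ * c₀ ^ (2 * α - 1)) * K * (K + 2 * c₀) ^ (2 * α - 1) /
        R ^ (4 * α - 2) * (ε₀ * (d ^ 2 / 4) ^ α) =
      K * d * (4 * (K + 2 * c₀) * (d / 2) / (c₀ * R ^ 2)) ^ (2 * α - 1) := by
  have h2 : (2 : ℝ) ^ (4 * α - 1) = 4 ^ (2 * α - 1) * 2 := by
    rw [show (4 : ℝ) = 2 ^ (2 : ℝ) by norm_num, ← Real.rpow_mul (by norm_num),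
      ← Real.rpow_add_one (by norm_num)]
    congr 1
    ring
  have hR2 : R ^ (4 * α - 2) = (R ^ 2) ^ (2 * α - 1) := by
    rw [← Real.rpow_two, ← Real.rpow_mul hR.le]
    congr 1
    ring
  rw [rpow_sq_div_four hd, h2, hR2,
    Real.div_rpow (show 0 ≤ 4 * (K + 2 * c₀) * (d / 2) by positivity) (by positivity),
    Real.mul_rpow (by positivity) (by positivity), Real.mul_rpow (by positivity) (by positivity),
    Real.mul_rpow hc₀.le (by positivity)]
  field_simp

theorem barrier_constant_mul_of_lt_half {R d K ε₀ : ℝ} (α : ℝ) (hR : 0 < R) (hd : 0 < d)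
    (hε₀ : 0 < ε₀) :
    (2 : ℝ) ^ (6 * α - 2) / ε₀ * K / R ^ (4 * α - 2) * (ε₀ * (d ^ 2 / 4) ^ α) =
      K * d * (8 * (d / 2) / R ^ 2) ^ (2 * α - 1) := by
  have h2 : (2 : ℝ) ^ (6 * α - 2) = 8 ^ (2 * α - 1) * 2 := by
    rw [show (8 : ℝ) = 2 ^ (3 : ℝ) by norm_num, ← Real.rpow_mul (by norm_num),
      ← Real.rpow_add_one (by norm_num)]
    congr 1
    ring
  have hR2 : R ^ (4 * α - 2) = (R ^ 2) ^ (2 * α - 1) := by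
    rw [← Real.rpow_two, ← Real.rpow_mul hR.le]
    congr 1
    ring
  rw [rpow_sq_div_four hd, h2, hR2,
    Real.div_rpow (show 0 ≤ 8 * (d / 2) by positivity) (by positivity),
    Real.mul_rpow (by positivity) (by positivity)]
  field_simp

/-- key barrier estimate in the proof of Theorem 1.5: with
`τ(x) = (r² - |x|²)²/4`, `r = R/2`, one has `-L τ ≤ (A/R^{4α-2}) ρ τ^α` in `B_r`. -/
theorem stmt9 {n : ℕ} (hn : 1 ≤ n) (R r : ℝ) (hR0 : 0 < R) (hR1 : R < 1) (hr : r = R / 2)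
    (a : Esp n → Fin n → Fin n → ℝ) (b : Esp n → Fin n → ℝ) (c : Esp n → ℝ)
    (ρ : Esp n → ℝ)
    (c₀ C₀ b₀ ε₀ : ℝ) (hc₀ : 0 < c₀) (hcC : c₀ ≤ C₀) (hb₀ : 0 ≤ b₀) (hε₀ : 0 < ε₀)
    (hell : ∀ x ∈ ball (0 : Esp n) r, ∀ ξ : Fin n → ℝ,
      c₀ * ∑ l, ξ l ^ 2 ≤ ∑ κ, ∑ l, a x κ l * ξ κ * ξ l ∧
      ∑ κ, ∑ l, a x κ l * ξ κ * ξ l ≤ C₀ * ∑ l, ξ l ^ 2)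
    (hb : ∀ x ∈ ball (0 : Esp n) r, Real.sqrt (∑ l, b x l ^ 2) ≤ b₀)
    (hc : ∀ x ∈ ball (0 : Esp n) r, |c x| ≤ b₀)
    (hρ : ∀ x ∈ ball (0 : Esp n) r, ε₀ ≤ ρ x)
    (α : ℝ) (hα : 0 < α)
    (A : ℝ)
    (hA : A = if (1 / 2 : ℝ) ≤ α then
        (2 : ℝ) ^ (4 * α - 1) / (ε₀ * c₀ ^ (2 * α - 1)) *
          (4 * n * C₀ + (9 / 4) * b₀) * (4 * n * C₀ + (9 / 4) * b₀ + 2 * c₀) ^ (2 * α - 1)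
      else (2 : ℝ) ^ (6 * α - 2) / ε₀ * (4 * n * C₀ + (9 / 4) * b₀))
    (τ : Esp n → ℝ) (hτ : ∀ y : Esp n, τ y = (r ^ 2 - ‖y‖ ^ 2) ^ 2 / 4) :
    ∀ x ∈ ball (0 : Esp n) r,
      -((∑ κ, ∑ l, a x κ l * pderiv2 τ κ l x) + (∑ l, b x l * pderiv1 τ l x) + c x * τ x) ≤
        A / R ^ (4 * α - 2) * (ρ x * τ x ^ α) := by
  intro x hx
  obtain rfl : τ = fun y : Esp n => (r ^ 2 - ‖y‖ ^ 2) ^ 2 / 4 := funext hτ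
  have hxr : ‖x‖ < r := by simpa using hx
  have hx0 : 0 ≤ ‖x‖ := norm_nonneg x
  have hnorm : ∑ l, x l ^ 2 = ‖x‖ ^ 2 := (EuclideanSpace.real_norm_sq_eq x).symm
  simp only [pderiv1_barrier, pderiv2_barrier]
  obtain ⟨d, hd_def⟩ : ∃ d, d = r ^ 2 - ‖x‖ ^ 2 := ⟨_, rfl⟩
  rw [← hd_def]
  have hd : 0 < d := by nlinarith
  have hdr : d ≤ r ^ 2 := by nlinarith
  have hd4 : d ≤ 1 / 4 := by nlinarith
  have hmain := neg_operator_barrier_le (a x) (b x) (fun l => x l) (c x) c₀ C₀ b₀ d (hell x hx)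
    (hb x hx) (hc x hx) hd.le hd4
    (by rw [hnorm, Real.sqrt_sq hx0]; linarith)
  rw [hnorm] at hmain
  have hC₀ : 0 < C₀ := hc₀.trans_le hcC
  set K := 4 * (n : ℝ) * C₀ + 9 / 4 * b₀ with hK_def
  have hK : 0 ≤ K := by positivity
  have hA0 : 0 ≤ A := by
    rw [hA]
    split_ifs <;> positivity
  have hρA : A / R ^ (4 * α - 2) * (ε₀ * (d ^ 2 / 4) ^ α) ≤
      A / R ^ (4 * α - 2) * (ρ x * (d ^ 2 / 4) ^ α) := by
    have := hρ x hx
    gcongr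
  refine hmain.trans (le_trans ?_ hρA)
  have hKd : 0 ≤ K * d := by positivity
  have hR2 : R ^ 2 = 4 * r ^ 2 := by rw [hr]; ring
  split_ifs at hA with hα2
  · rcases le_or_gt (d * (K / 4) - 2 * c₀ * ‖x‖ ^ 2) 0 with hneg | hpos
    · exact hneg.trans (by positivity)
    · rw [hA, barrier_constant_mul_of_half_le α hR0 hd hc₀ hK hε₀]
      have hbase : 1 ≤ 4 * (K + 2 * c₀) * (d / 2) / (c₀ * R ^ 2) := by
        rw [one_le_div (by positivity), hR2]
        nlinarith
      have hpow := Real.one_le_rpow hbase (show 0 ≤ 2 * α - 1 by linarith)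
      nlinarith [mul_le_mul_of_nonneg_left hpow hKd, mul_nonneg hc₀.le (sq_nonneg ‖x‖)]
  · rw [hA, barrier_constant_mul_of_lt_half α hR0 hd hε₀]
    have hbase : 8 * (d / 2) / R ^ 2 ≤ 1 := by
      rw [div_le_one (by positivity), hR2]
      linarith
    have hpow := Real.one_le_rpow_of_pos_of_le_one_of_nonpos
      (show 0 < 8 * (d / 2) / R ^ 2 by positivity) hbase
      (show 2 * α - 1 ≤ 0 by push Not at hα2; linarith)
    nlinarith [mul_le_mul_of_nonneg_left hpow hKd, mul_nonneg hc₀.le (sq_nonneg ‖x‖)]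
end
end

section
/- Let Ω = B_s := {x ∈ ℝⁿ : |x| < s} be an open ball, let γ ∈ (0,1), and let ρ₁ : closure(B_s) → ℝ be positive, bounded and γ-Hölder continuous. Then there exist λ > 0 and a principal eigenfunction (v₀, v₁, …, v_{m−1}) of the Navier eigenvalue problem (−Δ)^m v = λ ρ₁(x) v on B_s with eigenvalue λ; in particular v₀ > 0 and each v_j > 0 in B_s. -/
open MeasureTheory Metric Finset
open scoped ENNReal NNReal

noncomputable section

section Calculus

open Filter Topology

/-- The linear form on `ℝⁿ` with coefficients `c`. -/
def coordForm {n : ℕ} (c : Fin n → ℝ) : Esp n →L[ℝ] ℝ :=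
  ∑ l, c l • (EuclideanSpace.proj l : Esp n →L[ℝ] ℝ)

lemma coordForm_apply {n : ℕ} (c : Fin n → ℝ) (v : Esp n) : coordForm c v = ∑ l, c l * v l := by
  simp [coordForm]

lemma coordForm_single {n : ℕ} (c : Fin n → ℝ) (l : Fin n) :
    coordForm c (EuclideanSpace.single l 1) = c l := by
  simp [coordForm_apply]

lemma coordForm_sub {n : ℕ} (c d : Fin n → ℝ) :
    coordForm c - coordForm d = coordForm (fun l => c l - d l) := by
  ext v
  simp [coordForm_apply, sub_mul]

lemma coordForm_smul {n : ℕ} (a : ℝ) (c : Fin n → ℝ) :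
    a • coordForm c = coordForm (fun l => a * c l) := by
  ext v
  simp [coordForm_apply, Finset.mul_sum, mul_assoc]

lemma eq_coordForm {n : ℕ} (L : Esp n →L[ℝ] ℝ) :
    L = coordForm (fun l => L (EuclideanSpace.single l 1)) := by
  refine ContinuousLinearMap.coe_injective
    ((EuclideanSpace.basisFun (Fin n) ℝ).toBasis.ext fun i => ?_)
  simp [coordForm_single]

lemma norm_coordForm_le {n : ℕ} (c : Fin n → ℝ) : ‖coordForm c‖ ≤ ∑ l, |c l| := by
  refine ContinuousLinearMap.opNorm_le_bound _ (Finset.sum_nonneg fun l _ => abs_nonneg _) ?_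
  intro v
  rw [coordForm_apply, Finset.sum_mul]
  refine (norm_sum_le _ _).trans (Finset.sum_le_sum fun l _ => ?_)
  rw [norm_mul, Real.norm_eq_abs]
  exact mul_le_mul_of_nonneg_left (EuclideanSpace.norm_eq v ▸ PiLp.norm_apply_le v l)
    (abs_nonneg _)

lemma continuousOn_coordForm {n : ℕ} {X : Type*} [TopologicalSpace X] {c : Fin n → X → ℝ}
    {U : Set X} (hc : ∀ l, ContinuousOn (c l) U) :
    ContinuousOn (fun x => coordForm (fun l => c l x)) U := by
  unfold coordForm
  exact continuousOn_finsetSum _ fun l _ => (hc l).smul continuousOn_const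

/-- On `U`, the function `u` has gradient `g` and Hessian `W`, and `W` is continuous. -/
structure HasC2Data {n : ℕ} (U : Set (Esp n)) (u : Esp n → ℝ) (g : Fin n → Esp n → ℝ)
    (W : Fin n → Fin n → Esp n → ℝ) : Prop where
  grad : ∀ x ∈ U, HasFDerivAt u (coordForm fun l => g l x) x
  hess : ∀ l, ∀ x ∈ U, HasFDerivAt (g l) (coordForm fun κ => W κ l x) x
  cont : ∀ κ l, ContinuousOn (W κ l) U

namespace HasC2Data

variable {n : ℕ} {U : Set (Esp n)} {u u' : Esp n → ℝ} {g g' : Fin n → Esp n → ℝ}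
  {W W' : Fin n → Fin n → Esp n → ℝ}

lemma sub (h : HasC2Data U u g W) (h' : HasC2Data U u' g' W') :
    HasC2Data U (fun x => u x - u' x) (fun l x => g l x - g' l x)
      (fun κ l x => W κ l x - W' κ l x) where
  grad x hx := by
    have := (h.grad x hx).sub (h'.grad x hx)
    rwa [coordForm_sub] at this
  hess l x hx := by
    have := (h.hess l x hx).sub (h'.hess l x hx)
    rwa [coordForm_sub] at this
  cont κ l := (h.cont κ l).sub (h'.cont κ l)

lemma const_mul (h : HasC2Data U u g W) (a : ℝ) :
    HasC2Data U (fun x => a * u x) (fun l x => a * g l x) (fun κ l x => a * W κ l x) where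
  grad x hx := by
    have := (h.grad x hx).const_mul a
    rwa [coordForm_smul] at this
  hess l x hx := by
    have := (h.hess l x hx).const_mul a
    rwa [coordForm_smul] at this
  cont κ l := continuousOn_const.mul (h.cont κ l)

lemma congr (h : HasC2Data U u g W) (hU : IsOpen U) (he : ∀ x ∈ U, u' x = u x) :
    HasC2Data U u' g W where
  grad x hx := (h.grad x hx).congr_of_eventuallyEq
    (Filter.eventually_of_mem (hU.mem_nhds hx) he)
  hess := h.hess
  cont := h.cont

lemma pderiv1_eq (h : HasC2Data U u g W) {x : Esp n} (hx : x ∈ U) (l : Fin n) :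
    pderiv1 u l x = g l x := by
  rw [pderiv1, (h.grad x hx).fderiv, coordForm_single]

lemma pderiv2_eq (h : HasC2Data U u g W) (hU : IsOpen U) {x : Esp n} (hx : x ∈ U)
    (κ l : Fin n) : pderiv2 u κ l x = W κ l x := by
  have he : (fun y => fderiv ℝ u y (EuclideanSpace.single l 1)) =ᶠ[𝓝 x] g l :=
    Filter.eventually_of_mem (hU.mem_nhds hx) fun y hy => h.pderiv1_eq hy l
  rw [pderiv2, he.fderiv_eq, (h.hess l x hx).fderiv, coordForm_single]

lemma contDiffOn (h : HasC2Data U u g W) (hU : IsOpen U) : ContDiffOn ℝ 2 u U := by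
  have hg : ∀ l, ContDiffOn ℝ 1 (g l) U := by
    intro l
    rw [← zero_add (1 : WithTop ℕ∞), contDiffOn_succ_iff_fderiv_of_isOpen hU]
    refine ⟨fun x hx => (h.hess l x hx).differentiableAt.differentiableWithinAt, by simp, ?_⟩
    rw [contDiffOn_zero]
    exact (continuousOn_coordForm fun κ => h.cont κ l).congr fun x hx => (h.hess l x hx).fderiv
  rw [show (2 : WithTop ℕ∞) = 1 + 1 by norm_num, contDiffOn_succ_iff_fderiv_of_isOpen hU]
  refine ⟨fun x hx => (h.grad x hx).differentiableAt.differentiableWithinAt, by simp, ?_⟩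
  refine ContDiffOn.congr ?_ fun x hx => (h.grad x hx).fderiv
  unfold coordForm
  exact ContDiffOn.sum fun l _ => (hg l).smul contDiffOn_const

end HasC2Data

lemma hasFDerivAt_of_tendstoUniformlyOn_coord {n : ℕ} {U : Set (Esp n)} (hU : IsOpen U)
    {ι : Type*} {F : Filter ι} [F.NeBot] {u : ι → Esp n → ℝ} {g : ι → Fin n → Esp n → ℝ}
    {u₀ : Esp n → ℝ} {g₀ : Fin n → Esp n → ℝ}
    (h : ∀ i, ∀ x ∈ U, HasFDerivAt (u i) (coordForm fun l => g i l x) x)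
    (hu : ∀ x ∈ U, Tendsto (fun i => u i x) F (𝓝 (u₀ x)))
    (hg : ∀ l, TendstoUniformlyOn (fun i => g i l) (g₀ l) F U) {x : Esp n} (hx : x ∈ U) :
    HasFDerivAt u₀ (coordForm fun l => g₀ l x) x := by
  refine hasFDerivAt_of_tendstoUniformlyOn (g' := fun x => coordForm fun l => g₀ l x) hU
    ?_ h hu hx
  rw [Metric.tendstoUniformlyOn_iff]
  intro δ hδ
  have hδ' : 0 < δ / (n + 1) := by positivity
  have := Filter.eventually_all.2 fun l => (Metric.tendstoUniformlyOn_iff.1 (hg l)) _ hδ'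
  filter_upwards [this] with i hi y hy
  rw [dist_eq_norm, coordForm_sub]
  refine (norm_coordForm_le _).trans_lt ?_
  calc ∑ l, |g₀ l y - g i l y| ≤ ∑ _l : Fin n, δ / (n + 1) :=
        Finset.sum_le_sum fun l _ => (hi l y hy).le
    _ = n * (δ / (n + 1)) := by simp
    _ < δ := by
        rw [← mul_div_assoc, div_lt_iff₀ (by positivity)]
        nlinarith

lemma HasC2Data.of_tendsto {n : ℕ} {U : Set (Esp n)} (hU : IsOpen U)
    {ι : Type*} {F : Filter ι} [F.NeBot] {u : ι → Esp n → ℝ} {g : ι → Fin n → Esp n → ℝ}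
    {W : ι → Fin n → Fin n → Esp n → ℝ}
    {u₀ : Esp n → ℝ} {g₀ : Fin n → Esp n → ℝ} {W₀ : Fin n → Fin n → Esp n → ℝ}
    (h : ∀ i, HasC2Data U (u i) (g i) (W i))
    (hu : ∀ x ∈ U, Tendsto (fun i => u i x) F (𝓝 (u₀ x)))
    (hg : ∀ l, TendstoUniformlyOn (fun i => g i l) (g₀ l) F U)
    (hW : ∀ κ l, TendstoUniformlyOn (fun i => W i κ l) (W₀ κ l) F U) :
    HasC2Data U u₀ g₀ W₀ where
  grad _ hx := hasFDerivAt_of_tendstoUniformlyOn_coord hU (fun i => (h i).grad) hu hg hx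
  hess l _ hx := hasFDerivAt_of_tendstoUniformlyOn_coord (g := fun i κ => W i κ l) hU
    (fun i => (h i).hess l) (fun _ hy => (hg l).tendsto_at hy) (fun κ => hW κ l) hx
  cont κ l := (hW κ l).continuousOn (Filter.Eventually.frequently
    (Filter.Eventually.of_forall fun i => (h i).cont κ l))

end Calculus

section Potential

open Filter Topology

instance isFiniteMeasure_restrict_ball {n : ℕ} (x : Esp n) (s : ℝ) :
    IsFiniteMeasure (volume.restrict (ball x s)) :=
  isFiniteMeasure_restrict.2 measure_ball_lt_top.ne

lemma exists_bound_on_prod {n : ℕ} {r s : ℝ} {k : Esp n → Esp n → ℝ}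
    (hk : ContinuousOn (Function.uncurry k) (closedBall 0 r ×ˢ closedBall 0 s)) :
    ∃ M, ∀ x ∈ closedBall (0 : Esp n) r, ∀ y ∈ closedBall (0 : Esp n) s, |k x y| ≤ M := by
  obtain ⟨M, hM⟩ := ((isCompact_closedBall (0 : Esp n) r).prod
    (isCompact_closedBall (0 : Esp n) s)).exists_bound_of_continuousOn hk
  exact ⟨M, fun x hx y hy => hM (x, y) ⟨hx, hy⟩⟩

lemma continuousOn_slice {n : ℕ} {r s : ℝ} {k : Esp n → Esp n → ℝ}
    (hk : ContinuousOn (Function.uncurry k) (closedBall 0 r ×ˢ closedBall 0 s))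
    {x : Esp n} (hx : x ∈ closedBall (0 : Esp n) r) : ContinuousOn (k x) (ball 0 s) :=
  hk.comp (f := fun y => (x, y)) (by fun_prop) fun _ hy => ⟨hx, ball_subset_closedBall hy⟩

lemma integrableOn_slice {n : ℕ} {r s : ℝ} {k : Esp n → Esp n → ℝ}
    (hk : ContinuousOn (Function.uncurry k) (closedBall 0 r ×ˢ closedBall 0 s))
    {x : Esp n} (hx : x ∈ closedBall (0 : Esp n) r) : IntegrableOn (k x) (ball 0 s) := by
  have h : ContinuousOn (k x) (closedBall 0 s) :=
    hk.comp (f := fun y => (x, y)) (by fun_prop) fun _ hy => ⟨hx, hy⟩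
  exact (h.integrableOn_compact (isCompact_closedBall _ _)).mono_set ball_subset_closedBall

lemma continuousOn_ball_integral {n : ℕ} {r s : ℝ} {k : Esp n → Esp n → ℝ}
    (hk : ContinuousOn (Function.uncurry k) (closedBall 0 r ×ˢ closedBall 0 s)) :
    ContinuousOn (fun x => ∫ y in ball (0 : Esp n) s, k x y) (closedBall 0 r) := by
  obtain ⟨M, hM⟩ := exists_bound_on_prod hk
  refine continuousOn_of_dominated (bound := fun _ => M) (fun x hx =>
    (continuousOn_slice hk hx).aestronglyMeasurable measurableSet_ball) (fun x hx => ?_)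
    (integrable_const _) ?_
  · exact (ae_restrict_mem measurableSet_ball).mono fun y hy =>
      hM x hx y (ball_subset_closedBall hy)
  · refine (ae_restrict_mem measurableSet_ball).mono fun y hy => ?_
    exact hk.comp (f := fun x => (x, y)) (by fun_prop)
      fun _ hx => ⟨hx, ball_subset_closedBall hy⟩

lemma hasFDerivAt_ball_integral {n : ℕ} {r s : ℝ} {k : Esp n → Esp n → ℝ}
    {k' : Fin n → Esp n → Esp n → ℝ}
    (hk : ContinuousOn (Function.uncurry k) (closedBall 0 r ×ˢ closedBall 0 s))
    (hk' : ∀ l, ContinuousOn (Function.uncurry (k' l)) (closedBall 0 r ×ˢ closedBall 0 s))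
    (hd : ∀ x ∈ ball (0 : Esp n) r, ∀ y ∈ ball (0 : Esp n) s,
      HasFDerivAt (fun x => k x y) (coordForm fun l => k' l x y) x)
    {x : Esp n} (hx : x ∈ ball (0 : Esp n) r) :
    HasFDerivAt (fun x => ∫ y in ball (0 : Esp n) s, k x y)
      (coordForm fun l => ∫ y in ball (0 : Esp n) s, k' l x y) x := by
  choose M hM using fun l => exists_bound_on_prod (hk' l)
  have hx' := ball_subset_closedBall hx
  have hmeas : AEStronglyMeasurable (fun y => coordForm fun l => k' l x y)
      (volume.restrict (ball (0 : Esp n) s)) :=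
    (continuousOn_coordForm fun l => continuousOn_slice (hk' l) hx').aestronglyMeasurable
      measurableSet_ball
  have hbd : ∀ x ∈ ball (0 : Esp n) r, ∀ y ∈ ball (0 : Esp n) s,
      ‖coordForm fun l => k' l x y‖ ≤ ∑ l, M l := fun x hx y hy =>
    (norm_coordForm_le _).trans (Finset.sum_le_sum fun l _ =>
      hM l x (ball_subset_closedBall hx) y (ball_subset_closedBall hy))
  have key := hasFDerivAt_integral_of_dominated_of_fderiv_le
    (μ := volume.restrict (ball (0 : Esp n) s)) (F := k)
    (F' := fun x y => coordForm fun l => k' l x y) (bound := fun _ => ∑ l, M l)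
    (isOpen_ball.mem_nhds hx)
    (Filter.eventually_of_mem (isOpen_ball.mem_nhds hx) fun z hz =>
      (continuousOn_slice hk (ball_subset_closedBall hz)).aestronglyMeasurable
        measurableSet_ball)
    (integrableOn_slice hk hx') hmeas
    ((ae_restrict_mem measurableSet_ball).mono fun y hy z hz => hbd z hz y hy)
    (integrable_const _)
    ((ae_restrict_mem measurableSet_ball).mono fun y hy z hz => hd z hz y hy)
  refine key.congr_fderiv ?_
  rw [eq_coordForm (∫ y in ball (0 : Esp n) s, coordForm fun l => k' l x y)]
  congr 1
  ext l
  have hki : Integrable (fun y => coordForm fun l => k' l x y)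
      (volume.restrict (ball (0 : Esp n) s)) :=
    Integrable.of_bound hmeas (∑ l, M l)
      ((ae_restrict_mem measurableSet_ball).mono fun y hy => hbd x hx y hy)
  rw [ContinuousLinearMap.integral_apply hki]
  simp only [coordForm_single]

/-- A primitive of `-t ^ (-n/2)`; the function `x ↦ radialPrim n (‖x‖ ^ 2)` is harmonic on
`ℝⁿ` away from the origin. -/
def radialPrim (n : ℕ) (t : ℝ) : ℝ := ∫ τ in t..1, τ ^ (-((n : ℝ) / 2))

lemma intervalIntegrable_rpow_pos {p a b : ℝ} (ha : 0 < a) (hb : 0 < b) :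
    IntervalIntegrable (fun τ : ℝ => τ ^ p) volume a b := by
  refine intervalIntegral.intervalIntegrable_rpow (Or.inr ?_)
  intro h
  exact absurd h.1 (not_le.2 (lt_min ha hb))

lemma hasDerivAt_radialPrim (n : ℕ) {t : ℝ} (ht : 0 < t) :
    HasDerivAt (radialPrim n) (-t ^ (-((n : ℝ) / 2))) t := by
  unfold radialPrim
  refine intervalIntegral.integral_hasDerivAt_left (intervalIntegrable_rpow_pos ht one_pos) ?_ ?_
  · exact ContinuousAt.stronglyMeasurableAtFilter (s := Set.Ioi 0) isOpen_Ioi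
      (fun x hx => Real.continuousAt_rpow_const _ _ (Or.inl (ne_of_gt hx))) _ ht
  · exact Real.continuousAt_rpow_const _ _ (Or.inl ht.ne')

lemma radialPrim_sub {n : ℕ} {t t' : ℝ} (ht : 0 < t) (ht' : 0 < t') :
    radialPrim n t - radialPrim n t' = ∫ τ in t..t', τ ^ (-((n : ℝ) / 2)) := by
  unfold radialPrim
  exact intervalIntegral.integral_interval_sub_interval_comm'
    (intervalIntegrable_rpow_pos ht one_pos) (intervalIntegrable_rpow_pos ht' one_pos)
    (intervalIntegrable_rpow_pos ht ht') |>.trans (by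
      rw [intervalIntegral.integral_same, zero_sub, ← intervalIntegral.integral_symm])

/-- The quadratic polynomial `a ‖x‖² - 2 ⟨x, w⟩ + b`. -/
def quadPoly {n : ℕ} (a b : ℝ) (w x : Esp n) : ℝ := a * ‖x‖ ^ 2 - 2 * inner ℝ x w + b

/-- The gradient of `radialPrim n` composed with a quadratic polynomial of value `q`. -/
def kGrad {n : ℕ} (a q : ℝ) (w x : Esp n) (l : Fin n) : ℝ :=
  -2 * q ^ (-((n : ℝ) / 2)) * (a * x l - w l)

/-- The Hessian of `radialPrim n` composed with a quadratic polynomial of value `q`. -/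
def kHess {n : ℕ} (a q : ℝ) (w x : Esp n) (κ l : Fin n) : ℝ :=
  2 * n * q ^ (-((n : ℝ) / 2) - 1) * (a * x κ - w κ) * (a * x l - w l) -
    (if κ = l then 2 * a * q ^ (-((n : ℝ) / 2)) else 0)

lemma hasFDerivAt_quadPoly {n : ℕ} (a b : ℝ) (w x : Esp n) :
    HasFDerivAt (quadPoly a b w) (coordForm fun l => 2 * (a * x l - w l)) x := by
  have h1 : HasFDerivAt (fun x : Esp n => ‖x‖ ^ 2) (2 • innerSL ℝ x) x :=
    (hasStrictFDerivAt_norm_sq x).hasFDerivAt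
  have h2 : HasFDerivAt (fun x : Esp n => inner ℝ x w) (innerSL ℝ w) x := by
    have := (innerSL ℝ w).hasFDerivAt (x := x)
    refine this.congr_of_eventuallyEq (Filter.Eventually.of_forall fun y => ?_)
    simp [real_inner_comm]
  have h3 := ((h1.const_mul a).sub (h2.const_mul 2)).add_const b
  refine h3.congr_fderiv ?_
  ext v
  simp only [coordForm_apply, PiLp.inner_apply, RCLike.inner_apply, conj_trivial,
    sub_apply, smul_apply, innerSL_apply_apply, smul_eq_mul,
    nsmul_eq_mul, Finset.mul_sum, ← Finset.sum_sub_distrib, Nat.cast_ofNat]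
  exact Finset.sum_congr rfl fun l _ => by ring

lemma hasFDerivAt_radialPrim_quadPoly {n : ℕ} {a b : ℝ} {w x : Esp n}
    (h : 0 < quadPoly a b w x) :
    HasFDerivAt (fun x => radialPrim n (quadPoly a b w x))
      (coordForm (kGrad a (quadPoly a b w x) w x)) x := by
  have := (hasDerivAt_radialPrim n h).comp_hasFDerivAt x (hasFDerivAt_quadPoly a b w x)
  refine this.congr_fderiv ?_
  rw [coordForm_smul]
  congr 1
  ext l
  simp only [kGrad]
  ring

lemma hasFDerivAt_kGrad {n : ℕ} {a b : ℝ} {w x : Esp n} (h : 0 < quadPoly a b w x)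
    (l : Fin n) :
    HasFDerivAt (fun x => kGrad a (quadPoly a b w x) w x l)
      (coordForm fun κ => kHess a (quadPoly a b w x) w x κ l) x := by
  have h1 := (Real.hasDerivAt_rpow_const (p := -((n : ℝ) / 2)) (Or.inl h.ne')).comp_hasFDerivAt x
    (hasFDerivAt_quadPoly a b w x)
  have h2 : HasFDerivAt (fun x : Esp n => a * x l - w l)
      (coordForm fun κ => if κ = l then a else 0) x := by
    have := (((EuclideanSpace.proj l : Esp n →L[ℝ] ℝ).hasFDerivAt (x := x)).const_mul a).sub_const
      (w l)
    refine this.congr_fderiv ?_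
    ext v
    simp [coordForm_apply]
  have h3 := (h1.const_mul (-2)).mul h2
  refine h3.congr_fderiv ?_
  ext v
  simp only [coordForm_apply, add_apply, smul_apply,
    smul_eq_mul, Finset.mul_sum, ← Finset.sum_add_distrib, kHess, Function.comp]
  refine Finset.sum_congr rfl fun κ _ => ?_
  split_ifs <;> ring

variable {n : ℕ} {α β f : Esp n → ℝ} {r s : ℝ}

lemma continuous_quadPoly (hα : Continuous α) (hβ : Continuous β) :
    Continuous fun p : Esp n × Esp n => quadPoly (α p.2) (β p.2) p.2 p.1 := by
  unfold quadPoly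
  fun_prop

/-- Potentials whose kernel is `radialPrim n` composed with a positive quadratic polynomial
are of class `C²`. -/
lemma hasC2Data_potential (hα : Continuous α) (hβ : Continuous β) (hf : Continuous f)
    (hpos : ∀ x ∈ closedBall (0 : Esp n) r, ∀ y ∈ closedBall (0 : Esp n) s,
      0 < quadPoly (α y) (β y) y x) :
    HasC2Data (ball (0 : Esp n) r)
      (fun x => ∫ y in ball (0 : Esp n) s, radialPrim n (quadPoly (α y) (β y) y x) * f y)
      (fun l x => ∫ y in ball (0 : Esp n) s,
        kGrad (α y) (quadPoly (α y) (β y) y x) y x l * f y)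
      (fun κ l x => ∫ y in ball (0 : Esp n) s,
        kHess (α y) (quadPoly (α y) (β y) y x) y x κ l * f y) := by
  have hq := (continuous_quadPoly hα hβ).continuousOn (s := closedBall 0 r ×ˢ closedBall 0 s)
  have hp : ∀ p ∈ closedBall (0 : Esp n) r ×ˢ closedBall (0 : Esp n) s,
      0 < quadPoly (α p.2) (β p.2) p.2 p.1 := fun p hp => hpos p.1 hp.1 p.2 hp.2
  have hrpow : ∀ e : ℝ, ContinuousOn
      (fun p : Esp n × Esp n => quadPoly (α p.2) (β p.2) p.2 p.1 ^ e)
      (closedBall 0 r ×ˢ closedBall 0 s) := fun e =>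
    hq.rpow_const fun p h => Or.inl (hp p h).ne'
  have hlin : ∀ l, ContinuousOn (fun p : Esp n × Esp n => α p.2 * p.1 l - p.2 l)
      (closedBall 0 r ×ˢ closedBall 0 s) := fun l => by fun_prop
  have hα' : ContinuousOn (fun p : Esp n × Esp n => α p.2)
      (closedBall 0 r ×ˢ closedBall 0 s) := by fun_prop
  have hf' : ContinuousOn (fun p : Esp n × Esp n => f p.2)
      (closedBall 0 r ×ˢ closedBall 0 s) := by fun_prop
  have c0 : ContinuousOn (Function.uncurry fun x y =>
      radialPrim n (quadPoly (α y) (β y) y x) * f y) (closedBall 0 r ×ˢ closedBall 0 s) := by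
    refine ContinuousOn.mul (fun p h => ?_) hf'
    exact ContinuousAt.comp_continuousWithinAt
      (f := fun p : Esp n × Esp n => quadPoly (α p.2) (β p.2) p.2 p.1)
      (hasDerivAt_radialPrim n (hp p h)).continuousAt (hq p h)
  have c1 : ∀ l, ContinuousOn (Function.uncurry fun x y =>
      kGrad (α y) (quadPoly (α y) (β y) y x) y x l * f y)
      (closedBall 0 r ×ˢ closedBall 0 s) := fun l =>
    ((continuousOn_const.mul (hrpow _)).mul (hlin l)).mul hf'
  have c2 : ∀ κ l, ContinuousOn (Function.uncurry fun x y =>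
      kHess (α y) (quadPoly (α y) (β y) y x) y x κ l * f y)
      (closedBall 0 r ×ˢ closedBall 0 s) := by
    intro κ l
    refine ContinuousOn.mul (ContinuousOn.sub (((continuousOn_const.mul (hrpow _)).mul
      (hlin κ)).mul (hlin l)) ?_) hf'
    split_ifs
    · exact (continuousOn_const.mul hα').mul (hrpow _)
    · exact continuousOn_const
  refine ⟨fun x hx => ?_, fun l x hx => ?_, fun κ l => ?_⟩
  · refine hasFDerivAt_ball_integral c0 c1 (fun x hx y hy => ?_) hx
    have := (hasFDerivAt_radialPrim_quadPoly (hpos x (ball_subset_closedBall hx) y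
      (ball_subset_closedBall hy))).mul_const (f y)
    rw [coordForm_smul] at this
    refine this.congr_fderiv (congrArg _ (funext fun l => mul_comm _ _))
  · refine hasFDerivAt_ball_integral (c1 l) (fun κ => c2 κ l) (fun x hx y hy => ?_) hx
    have := (hasFDerivAt_kGrad (hpos x (ball_subset_closedBall hx) y
      (ball_subset_closedBall hy)) l).mul_const (f y)
    rw [coordForm_smul] at this
    refine this.congr_fderiv (congrArg _ (funext fun l => mul_comm _ _))
  · exact (continuousOn_ball_integral (c2 κ l)).mono ball_subset_closedBall

end Potential

section KernelEstimates

open Filter Topology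

variable {n : ℕ}

lemma radialPrim_sub_nonneg {t t' : ℝ} (ht : 0 < t) (h : t ≤ t') :
    0 ≤ radialPrim n t - radialPrim n t' := by
  rw [radialPrim_sub ht (ht.trans_le h)]
  exact intervalIntegral.integral_nonneg h fun τ hτ => Real.rpow_nonneg (ht.le.trans hτ.1) _

lemma radialPrim_sub_le (hn : 1 ≤ n) {t t' : ℝ} (ht : 0 < t) (h : t ≤ t') :
    radialPrim n t - radialPrim n t' ≤ 2 * t ^ ((1 - (n : ℝ)) / 2) * √(t' - t) := by
  have hn' : (1 : ℝ) ≤ n := by exact_mod_cast hn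
  have ht' := ht.trans_le h
  have hc : 0 ≤ t ^ ((1 - (n : ℝ)) / 2) := Real.rpow_nonneg ht.le _
  rw [radialPrim_sub ht ht']
  have h1 : ∫ τ in t..t', τ ^ (-((n : ℝ) / 2)) ≤
      ∫ τ in t..t', t ^ ((1 - (n : ℝ)) / 2) * τ ^ (-(1 / 2 : ℝ)) := by
    refine intervalIntegral.integral_mono_on h (intervalIntegrable_rpow_pos ht ht')
      ((intervalIntegrable_rpow_pos ht ht').const_mul _) fun τ hτ => ?_
    have hτ0 : 0 < τ := ht.trans_le hτ.1
    rw [show -((n : ℝ) / 2) = (1 - (n : ℝ)) / 2 + -(1 / 2 : ℝ) by ring, Real.rpow_add hτ0]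
    exact mul_le_mul_of_nonneg_right
      (Real.rpow_le_rpow_of_nonpos ht hτ.1 (by linarith)) (Real.rpow_nonneg hτ0.le _)
  refine h1.trans ?_
  rw [intervalIntegral.integral_const_mul, integral_rpow (Or.inl (by norm_num)),
    show -(1 / 2 : ℝ) + 1 = 1 / 2 by norm_num, ← Real.sqrt_eq_rpow, ← Real.sqrt_eq_rpow]
  have h2 : √t' - √t ≤ √(t' - t) := by
    rw [sub_le_iff_le_add, Real.sqrt_le_iff]
    refine ⟨by positivity, ?_⟩
    nlinarith [Real.sq_sqrt ht.le, Real.sq_sqrt (sub_nonneg.2 h),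
      mul_nonneg (Real.sqrt_nonneg (t' - t)) (Real.sqrt_nonneg t)]
  calc t ^ ((1 - (n : ℝ)) / 2) * ((√t' - √t) / (1 / 2))
      = 2 * t ^ ((1 - (n : ℝ)) / 2) * (√t' - √t) := by ring
    _ ≤ _ := mul_le_mul_of_nonneg_left h2 (by positivity)

lemma le_radialPrim_sub {t t' : ℝ} (ht : 0 < t) (h : t ≤ t') :
    (t' - t) * t' ^ (-((n : ℝ) / 2)) ≤ radialPrim n t - radialPrim n t' := by
  have ht' := ht.trans_le h
  rw [radialPrim_sub ht ht']
  have : ∫ _τ in t..t', t' ^ (-((n : ℝ) / 2)) ≤ ∫ τ in t..t', τ ^ (-((n : ℝ) / 2)) :=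
    intervalIntegral.integral_mono_on h intervalIntegrable_const
      (intervalIntegrable_rpow_pos ht ht') fun τ hτ =>
        Real.rpow_le_rpow_of_nonpos (ht.trans_le hτ.1) hτ.2
          (neg_nonpos.2 (by positivity))
  rwa [intervalIntegral.integral_const, smul_eq_mul] at this

lemma quadPoly_one (b : ℝ) (w x : Esp n) :
    quadPoly 1 (‖w‖ ^ 2 + b) w x = ‖x - w‖ ^ 2 + b := by
  rw [quadPoly, norm_sub_sq_real]
  ring

lemma sum_sq_sub (a : ℝ) (w x : Esp n) :
    ∑ l, (a * x l - w l) ^ 2 = a ^ 2 * ‖x‖ ^ 2 - 2 * a * inner ℝ x w + ‖w‖ ^ 2 := by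
  rw [EuclideanSpace.real_norm_sq_eq, EuclideanSpace.real_norm_sq_eq]
  simp only [PiLp.inner_apply, RCLike.inner_apply, conj_trivial, Finset.mul_sum,
    ← Finset.sum_sub_distrib, ← Finset.sum_add_distrib]
  exact Finset.sum_congr rfl fun l _ => by ring

lemma sum_sq_sub_one (w x : Esp n) : ∑ l, (1 * x l - w l) ^ 2 = ‖x - w‖ ^ 2 := by
  rw [sum_sq_sub, norm_sub_sq_real]
  ring

/-- The square of `(|y| / s) |x - y*|`, where `y*` is the reflection of `y` in the sphere of
radius `s`. -/
def reflSq (s : ℝ) (x y : Esp n) : ℝ := quadPoly (‖y‖ ^ 2 / s ^ 2) (s ^ 2) y x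

section Refl

variable {s : ℝ} {x y : Esp n}

lemma reflSq_eq (hs : 0 < s) (x y : Esp n) :
    reflSq s x y = ‖x - y‖ ^ 2 + (s ^ 2 - ‖x‖ ^ 2) * (s ^ 2 - ‖y‖ ^ 2) / s ^ 2 := by
  rw [reflSq, quadPoly, norm_sub_sq_real]
  field_simp
  ring

lemma sum_sq_reflSq (hs : 0 < s) (x y : Esp n) :
    ∑ l, (‖y‖ ^ 2 / s ^ 2 * x l - y l) ^ 2 = ‖y‖ ^ 2 / s ^ 2 * reflSq s x y := by
  rw [sum_sq_sub, reflSq, quadPoly]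
  field_simp

lemma sq_le_reflSq (hs : 0 < s) (x y : Esp n) :
    (s - ‖x‖ * ‖y‖ / s) ^ 2 ≤ reflSq s x y := by
  have := real_inner_le_norm x y
  rw [reflSq, quadPoly]
  have e : (s - ‖x‖ * ‖y‖ / s) ^ 2 = ‖y‖ ^ 2 / s ^ 2 * ‖x‖ ^ 2 - 2 * (‖x‖ * ‖y‖) + s ^ 2 := by
    field_simp
    ring
  rw [e]
  linarith

lemma reflSq_le (hs : 0 < s) (hx : ‖x‖ ≤ s) (hy : ‖y‖ ≤ s) : reflSq s x y ≤ (2 * s) ^ 2 := by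
  have h1 : -(‖x‖ * ‖y‖) ≤ inner ℝ x y := neg_le_of_abs_le (abs_real_inner_le_norm x y)
  have h2 : ‖x‖ * ‖y‖ ≤ s * s := mul_le_mul hx hy (norm_nonneg _) hs.le
  have h3 : ‖y‖ ^ 2 / s ^ 2 * ‖x‖ ^ 2 ≤ s ^ 2 := by
    rw [div_mul_eq_mul_div, div_le_iff₀ (by positivity)]
    have := mul_self_le_mul_self (by positivity) h2
    nlinarith
  rw [reflSq, quadPoly]
  nlinarith

lemma norm_sub_sq_le_reflSq (hs : 0 < s) (hx : ‖x‖ ≤ s) (hy : ‖y‖ ≤ s) :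
    ‖x - y‖ ^ 2 ≤ reflSq s x y := by
  rw [reflSq_eq hs]
  have h1 : 0 ≤ s ^ 2 - ‖x‖ ^ 2 := sub_nonneg.2 (pow_le_pow_left₀ (norm_nonneg _) hx 2)
  have h2 : 0 ≤ s ^ 2 - ‖y‖ ^ 2 := sub_nonneg.2 (pow_le_pow_left₀ (norm_nonneg _) hy 2)
  have : 0 ≤ (s ^ 2 - ‖x‖ ^ 2) * (s ^ 2 - ‖y‖ ^ 2) / s ^ 2 := by positivity
  linarith

lemma reflSq_pos (hs : 0 < s) (hx : ‖x‖ < s) (hy : ‖y‖ ≤ s) : 0 < reflSq s x y := by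
  refine lt_of_lt_of_le ?_ (sq_le_reflSq hs x y)
  have : ‖x‖ * ‖y‖ / s < s := by
    rw [div_lt_iff₀ hs]
    nlinarith [norm_nonneg x, norm_nonneg y]
  have : 0 < s - ‖x‖ * ‖y‖ / s := sub_pos.2 this
  positivity

lemma sub_norm_sq_le_reflSq (hs : 0 < s) (hx : ‖x‖ ≤ s) (hy : ‖y‖ ≤ s) :
    (s - ‖y‖) ^ 2 ≤ reflSq s x y := by
  refine le_trans (pow_le_pow_left₀ (sub_nonneg.2 hy) ?_ 2) (sq_le_reflSq hs x y)
  have : ‖x‖ * ‖y‖ / s ≤ ‖y‖ := by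
    rw [div_le_iff₀ hs]
    nlinarith [norm_nonneg y]
  linarith

end Refl

lemma abs_kGrad_le {a q : ℝ} {w x : Esp n} (hq : 0 < q)
    (h : ∑ l, (a * x l - w l) ^ 2 ≤ q) (l : Fin n) :
    |kGrad a q w x l| ≤ 2 * q ^ ((1 - (n : ℝ)) / 2) := by
  have hl : |a * x l - w l| ≤ q ^ (1 / 2 : ℝ) := by
    rw [← Real.sqrt_eq_rpow]
    refine Real.abs_le_sqrt (le_trans ?_ h)
    exact Finset.single_le_sum (f := fun l => (a * x l - w l) ^ 2) (fun i _ => sq_nonneg _)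
      (Finset.mem_univ l)
  rw [kGrad, abs_mul, abs_mul, abs_of_nonneg (Real.rpow_nonneg hq.le _),
    show (1 - (n : ℝ)) / 2 = -((n : ℝ) / 2) + 1 / 2 by ring, Real.rpow_add hq, abs_neg,
    abs_of_pos (zero_lt_two' ℝ), mul_assoc]
  gcongr

lemma abs_kHess_le {a q : ℝ} {w x : Esp n} (hq : 0 < q) (ha : 0 ≤ a) (ha1 : a ≤ 1)
    (h : ∑ l, (a * x l - w l) ^ 2 ≤ q) (κ l : Fin n) :
    |kHess a q w x κ l| ≤ (2 * n + 2) * q ^ (-((n : ℝ) / 2)) := by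
  have hl : ∀ l, |a * x l - w l| ≤ √q := fun l => by
    refine Real.abs_le_sqrt (le_trans ?_ h)
    exact Finset.single_le_sum (f := fun l => (a * x l - w l) ^ 2) (fun i _ => sq_nonneg _)
      (Finset.mem_univ l)
  have hp : 0 ≤ q ^ (-((n : ℝ) / 2)) := Real.rpow_nonneg hq.le _
  have hp' : 0 ≤ q ^ (-((n : ℝ) / 2) - 1) := Real.rpow_nonneg hq.le _
  have h1 : |2 * n * q ^ (-((n : ℝ) / 2) - 1) * (a * x κ - w κ) * (a * x l - w l)| ≤
      2 * n * q ^ (-((n : ℝ) / 2)) := by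
    rw [mul_assoc, abs_mul, abs_mul (a * x κ - w κ), abs_of_nonneg (by positivity)]
    calc _ ≤ 2 * n * q ^ (-((n : ℝ) / 2) - 1) * (√q * √q) := by
          gcongr
          · exact hl κ
          · exact hl l
      _ = _ := by
          rw [Real.mul_self_sqrt hq.le, Real.rpow_sub_one hq.ne']
          field_simp
  have h2 : |if κ = l then 2 * a * q ^ (-((n : ℝ) / 2)) else 0| ≤
      2 * q ^ (-((n : ℝ) / 2)) := by
    split_ifs
    · rw [abs_of_nonneg (by positivity)]
      nlinarith
    · simpa using hp
  calc _ ≤ _ := abs_sub _ _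
    _ ≤ _ := add_le_add h1 h2
    _ = _ := by ring

lemma sum_kHess {a q δ : ℝ} {w x : Esp n} (hq : 0 < q)
    (h : ∑ l, (a * x l - w l) ^ 2 = a * q - δ) :
    ∑ l, kHess a q w x l l = -(2 * n * δ * q ^ (-((n : ℝ) / 2) - 1)) := by
  have : ∀ l, kHess a q w x l l = 2 * n * q ^ (-((n : ℝ) / 2) - 1) * (a * x l - w l) ^ 2 -
      2 * a * q ^ (-((n : ℝ) / 2)) := fun l => by
    simp only [kHess, if_true]
    ring
  simp only [this, Finset.sum_sub_distrib, ← Finset.mul_sum, h, Finset.sum_const,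
    Finset.card_univ, Fintype.card_fin, nsmul_eq_mul]
  rw [Real.rpow_sub_one hq.ne']
  field_simp
  ring

lemma integrableOn_norm_rpow_ball (hn : 1 ≤ n) {p : ℝ} (hp : -(n : ℝ) < p) (R : ℝ) :
    IntegrableOn (fun z : Esp n => ‖z‖ ^ p) (ball 0 R) := by
  have : Nonempty (Fin n) := ⟨⟨0, hn⟩⟩
  have h := (integrable_fun_norm_addHaar (volume : Measure (Esp n))
    (f := (Set.Iio R).indicator fun r => r ^ p)).2 ?_
  · have e : (fun z : Esp n => (Set.Iio R).indicator (fun r => r ^ p) ‖z‖) =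
        (ball (0 : Esp n) R).indicator fun z => ‖z‖ ^ p := by
      ext z
      by_cases hz : ‖z‖ < R <;> simp [Set.indicator, hz]
    rw [e, integrable_indicator_iff measurableSet_ball] at h
    exact h
  · have e : (fun r : ℝ => r ^ (Module.finrank ℝ (Esp n) - 1) •
        (Set.Iio R).indicator (fun r => r ^ p) r) =
        (Set.Iio R).indicator fun r : ℝ => r ^ (n - 1) * r ^ p := by
      ext r
      by_cases hr : r < R <;> simp [Set.indicator, hr]
    rw [e, integrableOn_indicator_iff measurableSet_Iio]
    have h1 : IntegrableOn (fun r : ℝ => r ^ ((n : ℝ) - 1 + p)) (Set.Ioo 0 R) :=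
      (intervalIntegral.intervalIntegrable_rpow' (by linarith)).1.mono_set Set.Ioo_subset_Ioc_self
    rw [Set.inter_comm, Set.Ioi_inter_Iio]
    refine h1.congr_fun (fun r hr => ?_) measurableSet_Ioo
    simp only
    rw [Real.rpow_add hr.1, ← Real.rpow_natCast, Nat.cast_sub hn, Nat.cast_one]

/-- The integral of a power of the norm over the ball of radius `2 s`. -/
def rieszConst (n : ℕ) (s p : ℝ) : ℝ := ∫ z in ball (0 : Esp n) (2 * s), ‖z‖ ^ p

lemma rieszConst_nonneg (n : ℕ) (s p : ℝ) : 0 ≤ rieszConst n s p :=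
  integral_nonneg fun z => Real.rpow_nonneg (norm_nonneg z) _

lemma ball_subset_preimage_sub {s : ℝ} {x : Esp n} (hx : ‖x‖ ≤ s) :
    ball (0 : Esp n) s ⊆ (fun y => x - y) ⁻¹' ball 0 (2 * s) := fun y hy => by
  rw [mem_ball_zero_iff] at hy
  simp only [Set.mem_preimage, mem_ball_zero_iff]
  linarith [norm_sub_le x y]

lemma integrableOn_comp_sub_ball {k : Esp n → ℝ} {s : ℝ} {x : Esp n}
    (hk : IntegrableOn k (ball 0 (2 * s))) (hx : ‖x‖ ≤ s) :
    IntegrableOn (fun y => k (x - y)) (ball 0 s) := by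
  have h := (volume.measurePreserving_sub_left x).integrableOn_comp_preimage
    (MeasurableEquiv.subLeft x).measurableEmbedding (f := k) (s := ball (0 : Esp n) (2 * s))
  exact (h.2 hk).mono_set (ball_subset_preimage_sub hx)

lemma setIntegral_comp_sub_ball_le {k : Esp n → ℝ} {s : ℝ} {x : Esp n} (hk0 : ∀ z, 0 ≤ k z)
    (hk : IntegrableOn k (ball 0 (2 * s))) (hx : ‖x‖ ≤ s) :
    ∫ y in ball (0 : Esp n) s, k (x - y) ≤ ∫ z in ball (0 : Esp n) (2 * s), k z := by
  have h := (volume.measurePreserving_sub_left x).integrableOn_comp_preimage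
    (MeasurableEquiv.subLeft x).measurableEmbedding (f := k) (s := ball (0 : Esp n) (2 * s))
  have h' := (volume.measurePreserving_sub_left x).setIntegral_preimage_emb
    (MeasurableEquiv.subLeft x).measurableEmbedding k (ball (0 : Esp n) (2 * s))
  rw [← h']
  exact setIntegral_mono_set (h.2 hk) (Filter.Eventually.of_forall fun y => hk0 _)
    (ball_subset_preimage_sub hx).eventuallyLE

end KernelEstimates

section NewtonPotential

open Filter Topology

variable {n : ℕ}

lemma ae_ne_zero_restrict (hn : 1 ≤ n) (S : Set (Esp n)) :
    ∀ᵐ z ∂(volume.restrict S), z ≠ 0 := by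
  have : Nonempty (Fin n) := ⟨⟨0, hn⟩⟩
  exact ae_restrict_of_ae (Measure.ae_ne volume 0)

lemma aestronglyMeasurable_radialPrim (hn : 1 ≤ n) {ε : ℝ} (hε : 0 ≤ ε) (S : Set (Esp n)) :
    AEStronglyMeasurable (fun z : Esp n => radialPrim n (‖z‖ ^ 2 + ε)) (volume.restrict S) := by
  have : Nonempty (Fin n) := ⟨⟨0, hn⟩⟩
  have h : ContinuousOn (fun z : Esp n => radialPrim n (‖z‖ ^ 2 + ε)) {0}ᶜ := by
    intro z hz
    have hz' : 0 < ‖z‖ ^ 2 + ε := by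
      have : 0 < ‖z‖ := norm_pos_iff.2 hz
      positivity
    exact ContinuousAt.comp_continuousWithinAt (f := fun z : Esp n => ‖z‖ ^ 2 + ε)
      (hasDerivAt_radialPrim n hz').continuousAt (by fun_prop)
  have h' := h.aestronglyMeasurable (μ := volume) (measurableSet_singleton 0).compl
  have e : volume.restrict ({0}ᶜ : Set (Esp n)) = volume :=
    Measure.restrict_eq_self_of_ae_mem (Measure.ae_ne volume (0 : Esp n))
  rw [e] at h'
  exact h'.restrict

/-- A sequence of positive regularization parameters tending to zero. -/
def regSeq (j : ℕ) : ℝ := 1 / ((j : ℝ) + 1)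

lemma regSeq_pos (j : ℕ) : 0 < regSeq j := by
  unfold regSeq
  positivity

lemma regSeq_le_one (j : ℕ) : regSeq j ≤ 1 := by
  unfold regSeq
  rw [div_le_one (by positivity)]
  linarith [(Nat.cast_nonneg j : (0 : ℝ) ≤ j)]

lemma tendsto_regSeq : Tendsto regSeq atTop (𝓝 0) := tendsto_one_div_add_atTop_nhds_zero_nat

lemma tendsto_integral_abs_sub (hn : 1 ≤ n) {k : ℝ → Esp n → ℝ} {b : Esp n → ℝ}
    {S : Set (Esp n)} (hS : MeasurableSet S) (hb : IntegrableOn b S)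
    (hm : ∀ ε, 0 ≤ ε → AEStronglyMeasurable (k ε) (volume.restrict S))
    (hbd : ∀ ε, 0 ≤ ε → ε ≤ 1 → ∀ z ∈ S, z ≠ 0 → |k ε z| ≤ b z)
    (hlim : ∀ z ≠ 0, Tendsto (fun j => k (regSeq j) z) atTop (𝓝 (k 0 z))) :
    Tendsto (fun j => ∫ z in S, |k (regSeq j) z - k 0 z|) atTop (𝓝 0) := by
  have h := tendsto_integral_of_dominated_convergence (μ := volume.restrict S)
    (F := fun j z => |k (regSeq j) z - k 0 z|) (f := fun _ => 0) (fun z => b z + b z)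
    (fun j => ((hm _ (regSeq_pos j).le).sub (hm 0 le_rfl)).norm) (hb.add hb) ?_ ?_
  · simpa using h
  · intro j
    filter_upwards [ae_restrict_mem hS, ae_ne_zero_restrict hn S] with z hz hz0
    rw [Real.norm_eq_abs, abs_abs]
    exact (abs_sub _ _).trans (add_le_add (hbd _ (regSeq_pos j).le (regSeq_le_one j) z hz hz0)
      (hbd 0 le_rfl zero_le_one z hz hz0))
  · filter_upwards [ae_ne_zero_restrict hn S] with z hz0
    have := ((hlim z hz0).sub_const (k 0 z)).abs
    simpa using this

lemma integrableOn_of_abs_le (hn : 1 ≤ n) {k b : Esp n → ℝ} {S : Set (Esp n)}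
    (hS : MeasurableSet S) (hb : IntegrableOn b S)
    (hm : AEStronglyMeasurable k (volume.restrict S))
    (hbd : ∀ z ∈ S, z ≠ 0 → |k z| ≤ b z) : IntegrableOn k S := by
  refine Integrable.mono' hb hm ?_
  filter_upwards [ae_restrict_mem hS, ae_ne_zero_restrict hn S] with z hz hz0
  exact hbd z hz hz0

lemma abs_convolution_le {k : Esp n → ℝ} {s M : ℝ} {f : Esp n → ℝ} (hM : ∀ y, |f y| ≤ M)
    (hk : IntegrableOn k (ball 0 (2 * s))) {x : Esp n} (hx : ‖x‖ ≤ s) :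
    |∫ y in ball (0 : Esp n) s, k (x - y) * f y| ≤
      M * ∫ z in ball (0 : Esp n) (2 * s), |k z| := by
  have hM0 : 0 ≤ M := (abs_nonneg _).trans (hM 0)
  have hk' := integrableOn_comp_sub_ball hk hx
  calc _ ≤ ∫ y in ball (0 : Esp n) s, M * |k (x - y)| := by
        rw [← Real.norm_eq_abs]
        refine norm_integral_le_of_norm_le (Integrable.const_mul (Integrable.abs hk') M)
          (Filter.Eventually.of_forall fun y => ?_)
        rw [norm_mul, Real.norm_eq_abs, Real.norm_eq_abs, mul_comm]
        exact mul_le_mul_of_nonneg_right (hM y) (abs_nonneg _)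
    _ ≤ _ := by
        rw [integral_const_mul]
        exact mul_le_mul_of_nonneg_left
          (setIntegral_comp_sub_ball_le (k := fun z => |k z|) (fun _ => abs_nonneg _) hk.abs hx) hM0

lemma integrableOn_convolution {k : Esp n → ℝ} {s M : ℝ} {f : Esp n → ℝ} (hM : ∀ y, |f y| ≤ M)
    (hf : Continuous f)
    (hk : IntegrableOn k (ball 0 (2 * s))) {x : Esp n} (hx : ‖x‖ ≤ s) :
    IntegrableOn (fun y => k (x - y) * f y) (ball 0 s) := by
  refine Integrable.mul_bdd (c := M) (integrableOn_comp_sub_ball hk hx) hf.aestronglyMeasurable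
    (Filter.Eventually.of_forall hM)

lemma tendstoUniformlyOn_convolution {k : ℝ → Esp n → ℝ} {s M : ℝ} {f : Esp n → ℝ}
    (hM : ∀ y, |f y| ≤ M) (hf : Continuous f)
    (hk : ∀ ε, 0 ≤ ε → ε ≤ 1 → IntegrableOn (k ε) (ball 0 (2 * s)))
    (hlim : Tendsto (fun j => ∫ z in ball (0 : Esp n) (2 * s), |k (regSeq j) z - k 0 z|)
      atTop (𝓝 0)) :
    TendstoUniformlyOn (fun j x => ∫ y in ball (0 : Esp n) s, k (regSeq j) (x - y) * f y)
      (fun x => ∫ y in ball (0 : Esp n) s, k 0 (x - y) * f y) atTop (ball 0 s) := by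
  rw [Metric.tendstoUniformlyOn_iff]
  intro δ hδ
  have h1 : Tendsto (fun j => M * ∫ z in ball (0 : Esp n) (2 * s), |k (regSeq j) z - k 0 z|)
      atTop (𝓝 0) := by simpa using hlim.const_mul M
  filter_upwards [h1.eventually (gt_mem_nhds hδ)] with j hj x hx
  have hx' : ‖x‖ ≤ s := (mem_ball_zero_iff.1 hx).le
  have hkj := hk _ (regSeq_pos j).le (regSeq_le_one j)
  have hk0 := hk 0 le_rfl zero_le_one
  rw [dist_comm, Real.dist_eq, ← integral_sub (integrableOn_convolution hM hf hkj hx')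
    (integrableOn_convolution hM hf hk0 hx')]
  simp only [← sub_mul]
  exact (abs_convolution_le (k := fun z => k (regSeq j) z - k 0 z) hM (hkj.sub hk0)
    hx').trans_lt hj

/-- Hölder continuous functions on `ℝⁿ` vanishing outside the ball of radius `s`. -/
def IsHolderZero (s γ : ℝ) (f : Esp n → ℝ) : Prop :=
  (∃ C, 0 ≤ C ∧ ∀ x y, |f x - f y| ≤ C * ‖x - y‖ ^ γ) ∧ ∀ x, s ≤ ‖x‖ → f x = 0

lemma IsHolderZero.continuous {s γ : ℝ} (hγ : 0 < γ) {f : Esp n → ℝ} (h : IsHolderZero s γ f) :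
    Continuous f := by
  obtain ⟨⟨C, -, hC⟩, -⟩ := h
  refine continuous_iff_continuousAt.2 fun x => ?_
  rw [ContinuousAt, tendsto_iff_dist_tendsto_zero]
  have hg : Continuous fun y : Esp n => C * ‖y - x‖ ^ γ :=
    continuous_const.mul ((continuous_norm.comp (continuous_id.sub continuous_const)).rpow_const
      fun _ => Or.inr hγ.le)
  have := hg.tendsto x
  simp only [sub_self, norm_zero, Real.zero_rpow hγ.ne', mul_zero] at this
  exact squeeze_zero (fun _ => dist_nonneg) (fun y => hC y x) this

lemma IsHolderZero.bounded {s γ : ℝ} (hγ : 0 < γ) {f : Esp n → ℝ} (h : IsHolderZero s γ f) :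
    ∃ M, ∀ x, |f x| ≤ M := by
  have hs : HasCompactSupport f := by
    refine HasCompactSupport.intro (isCompact_closedBall (0 : Esp n) s) fun x hx => h.2 x ?_
    rw [mem_closedBall_zero_iff, not_le] at hx
    exact hx.le
  exact hs.exists_bound_of_continuous (h.continuous hγ)

lemma setIntegral_comp_sub_eq {k f : Esp n → ℝ} {s : ℝ} (hf : ∀ x, s ≤ ‖x‖ → f x = 0)
    {x : Esp n} (hx : ‖x‖ ≤ s) :
    ∫ y in ball (0 : Esp n) s, k (x - y) * f y =
      ∫ z in ball (0 : Esp n) (2 * s), k z * f (x - z) := by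
  rw [setIntegral_eq_integral_of_forall_compl_eq_zero,
    setIntegral_eq_integral_of_forall_compl_eq_zero, ← integral_sub_left_eq_self _ volume x]
  · simp
  · intro z hz
    rw [mem_ball_zero_iff, not_lt] at hz
    rw [hf _ (by linarith [norm_sub_norm_le z x, norm_sub_rev z x]), mul_zero]
  · intro y hy
    rw [mem_ball_zero_iff, not_lt] at hy
    rw [hf _ hy, mul_zero]

/-- The Gauss mass of the Laplacian of the fundamental solution, up to the factor `-2 n`. -/
def poissonMass (n : ℕ) : ℝ := ∫ w : Esp n, (1 + ‖w‖ ^ 2) ^ (-((n : ℝ) / 2) - 1)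

lemma integrable_poissonMass (n : ℕ) :
    Integrable fun w : Esp n => (1 + ‖w‖ ^ 2) ^ (-((n : ℝ) / 2) - 1) := by
  have := integrable_rpow_neg_one_add_norm_sq (E := Esp n) (μ := volume) (r := (n : ℝ) + 2)
    (by simp)
  rwa [show -((n : ℝ) + 2) / 2 = -((n : ℝ) / 2) - 1 by ring] at this

lemma poissonMass_pos (n : ℕ) : 0 < poissonMass n := by
  have hpos : ∀ w : Esp n, 0 < (1 + ‖w‖ ^ 2) ^ (-((n : ℝ) / 2) - 1) := fun w =>
    Real.rpow_pos_of_pos (by positivity) _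
  refine (integral_pos_iff_support_of_nonneg (fun w => (hpos w).le)
    (integrable_poissonMass n)).2 ?_
  rw [Function.support_eq_univ fun w => (hpos w).ne']
  exact Measure.measure_univ_pos.2 (NeZero.ne _)

lemma tendsto_poissonMass {R : ℝ} (hR : 0 < R) :
    Tendsto (fun j => ∫ z in ball (0 : Esp n) R,
      regSeq j * (‖z‖ ^ 2 + regSeq j) ^ (-((n : ℝ) / 2) - 1)) atTop (𝓝 (poissonMass n)) := by
  have e : ∀ j, ∫ z in ball (0 : Esp n) R,
      regSeq j * (‖z‖ ^ 2 + regSeq j) ^ (-((n : ℝ) / 2) - 1) =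
      ∫ w in ball (0 : Esp n) (R / √(regSeq j)), (1 + ‖w‖ ^ 2) ^ (-((n : ℝ) / 2) - 1) := by
    intro j
    have hε := regSeq_pos j
    set ε := regSeq j
    have hδ : 0 < √ε := Real.sqrt_pos.2 hε
    have h := Measure.setIntegral_comp_smul_of_pos (volume : Measure (Esp n))
      (fun z => ε * (‖z‖ ^ 2 + ε) ^ (-((n : ℝ) / 2) - 1)) (ball 0 (R / √ε)) hδ
    rw [_root_.smul_ball hδ.ne', smul_zero, Real.norm_of_nonneg hδ.le, mul_div_cancel₀ _ hδ.ne',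
      finrank_euclideanSpace_fin] at h
    have h2 : ∀ w : Esp n, ε * (‖√ε • w‖ ^ 2 + ε) ^ (-((n : ℝ) / 2) - 1) =
        (√ε ^ n)⁻¹ * (1 + ‖w‖ ^ 2) ^ (-((n : ℝ) / 2) - 1) := by
      intro w
      rw [norm_smul, Real.norm_of_nonneg hδ.le, mul_pow, Real.sq_sqrt hε.le,
        show ε * ‖w‖ ^ 2 + ε = ε * (1 + ‖w‖ ^ 2) by ring, Real.mul_rpow hε.le (by positivity),
        ← mul_assoc, Real.rpow_sub_one hε.ne', mul_div_cancel₀ _ hε.ne', Real.rpow_neg hε.le,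
        Real.sqrt_eq_rpow, ← Real.rpow_mul_natCast hε.le]
      congr 3
      ring
    simp only [h2, integral_const_mul, smul_eq_mul] at h
    rw [integral_const_mul]
    exact (mul_left_cancel₀ (by positivity) h).symm
  simp only [e]
  refine (aecover_ball ?_).integral_tendsto_of_countably_generated (integrable_poissonMass n)
  refine Tendsto.const_mul_atTop' hR ?_ |>.congr fun j => (div_eq_mul_inv _ _).symm
  refine Tendsto.inv_tendsto_nhdsGT_zero ?_
  refine tendsto_nhdsWithin_iff.2 ⟨?_, Filter.Eventually.of_forall fun j =>
    Real.sqrt_pos.2 (regSeq_pos j)⟩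
  have := (Real.continuous_sqrt.tendsto 0).comp tendsto_regSeq
  rwa [Real.sqrt_zero] at this

lemma setIntegral_ball_comp_isometry (e : Esp n ≃ₗᵢ[ℝ] Esp n) (R : ℝ) (h : Esp n → ℝ) :
    ∫ z in ball (0 : Esp n) R, h (e z) = ∫ z in ball (0 : Esp n) R, h z := by
  have := e.measurePreserving.setIntegral_preimage_emb
    e.toHomeomorph.measurableEmbedding h (ball 0 R)
  rwa [show e ⁻¹' ball (0 : Esp n) R = ball 0 R by ext z; simp] at this

/-- The change of sign of the coordinate `κ`. -/
def flipCoord (κ : Fin n) : Esp n ≃ₗᵢ[ℝ] Esp n :=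
  LinearIsometryEquiv.piLpCongrRight 2 fun i =>
    if i = κ then LinearIsometryEquiv.neg ℝ else LinearIsometryEquiv.refl ℝ ℝ

lemma flipCoord_apply (κ i : Fin n) (z : Esp n) :
    flipCoord κ z i = if i = κ then -z i else z i := by
  simp only [flipCoord, LinearIsometryEquiv.piLpCongrRight_apply]
  split_ifs <;> simp_all

lemma integral_kHess_of_ne {κ l : Fin n} (h : κ ≠ l) (R ε : ℝ) :
    ∫ z in ball (0 : Esp n) R, kHess 1 (‖z‖ ^ 2 + ε) 0 z κ l = 0 := by
  have h1 := setIntegral_ball_comp_isometry (flipCoord κ) R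
    fun z => kHess 1 (‖z‖ ^ 2 + ε) 0 z κ l
  have h2 : ∀ z : Esp n, kHess 1 (‖flipCoord κ z‖ ^ 2 + ε) 0 (flipCoord κ z) κ l =
      -kHess 1 (‖z‖ ^ 2 + ε) 0 z κ l := fun z => by
    simp [kHess, flipCoord_apply, h, h.symm]
  simp only [h2, integral_neg] at h1
  linarith

lemma integral_kHess_self_eq (κ l : Fin n) (R ε : ℝ) :
    ∫ z in ball (0 : Esp n) R, kHess 1 (‖z‖ ^ 2 + ε) 0 z κ κ =
      ∫ z in ball (0 : Esp n) R, kHess 1 (‖z‖ ^ 2 + ε) 0 z l l := by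
  have h1 := setIntegral_ball_comp_isometry
    (LinearIsometryEquiv.piLpCongrLeft 2 ℝ ℝ (Equiv.swap κ l)) R
    fun z => kHess 1 (‖z‖ ^ 2 + ε) 0 z κ κ
  rw [← h1]
  refine integral_congr_ae (Filter.Eventually.of_forall fun z => ?_)
  simp [kHess, LinearIsometryEquiv.piLpCongrLeft_apply]

end NewtonPotential

section NewtonPotential

open Filter Topology

variable {n : ℕ}

lemma sq_rpow_half {a : ℝ} (ha : 0 ≤ a) (p : ℝ) : (a ^ 2) ^ (p / 2) = a ^ p := by
  rw [← Real.rpow_natCast, ← Real.rpow_mul ha]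
  congr 1
  push_cast
  ring

lemma sq_add_rpow_le {z : Esp n} (hz : z ≠ 0) {ε p : ℝ} (hε : 0 ≤ ε) (hp : p ≤ 0) :
    (‖z‖ ^ 2 + ε) ^ (p / 2) ≤ ‖z‖ ^ p := by
  rw [← sq_rpow_half (norm_nonneg z)]
  exact Real.rpow_le_rpow_of_nonpos (pow_pos (norm_pos_iff.2 hz) 2) (by linarith) (by linarith)

lemma sq_add_pos {z : Esp n} (hz : z ≠ 0) {ε : ℝ} (hε : 0 ≤ ε) : 0 < ‖z‖ ^ 2 + ε := by
  have := pow_pos (norm_pos_iff.2 hz) 2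
  linarith

lemma tendsto_sq_add_regSeq (z : Esp n) :
    Tendsto (fun j => ‖z‖ ^ 2 + regSeq j) atTop (𝓝 (‖z‖ ^ 2 + 0)) :=
  tendsto_const_nhds.add tendsto_regSeq

lemma sum_sq_sub_zero (z : Esp n) : ∑ l, (1 * z l - (0 : Esp n) l) ^ 2 = ‖z‖ ^ 2 := by
  rw [sum_sq_sub_one, sub_zero]

/-- An integrable majorant of the regularized fundamental solutions. -/
def primBound (n : ℕ) (s : ℝ) (z : Esp n) : ℝ :=
  |radialPrim n ((2 * s) ^ 2 + 1)| + 2 * √((2 * s) ^ 2 + 1) * ‖z‖ ^ (1 - (n : ℝ))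

lemma integrableOn_primBound (hn : 1 ≤ n) (s : ℝ) :
    IntegrableOn (primBound n s) (ball 0 (2 * s)) :=
  (integrable_const _).add
    ((integrableOn_norm_rpow_ball hn (by linarith) _).const_mul _)

lemma abs_radialPrim_le (hn : 1 ≤ n) {s : ℝ} {z : Esp n} (hz : z ∈ ball (0 : Esp n) (2 * s))
    (hz0 : z ≠ 0) {ε : ℝ} (hε : 0 ≤ ε) (hε1 : ε ≤ 1) :
    |radialPrim n (‖z‖ ^ 2 + ε)| ≤ primBound n s z := by
  have hn' : (1 : ℝ) ≤ n := by exact_mod_cast hn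
  have hq := sq_add_pos hz0 hε
  have hle : ‖z‖ ^ 2 + ε ≤ (2 * s) ^ 2 + 1 := by
    have := pow_le_pow_left₀ (norm_nonneg z) (mem_ball_zero_iff.1 hz).le 2
    linarith
  have h1 := radialPrim_sub_nonneg (n := n) hq hle
  have h2 := radialPrim_sub_le hn hq hle
  have h3 : 2 * (‖z‖ ^ 2 + ε) ^ ((1 - (n : ℝ)) / 2) * √((2 * s) ^ 2 + 1 - (‖z‖ ^ 2 + ε)) ≤
      2 * ‖z‖ ^ (1 - (n : ℝ)) * √((2 * s) ^ 2 + 1) := by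
    refine mul_le_mul (mul_le_mul_of_nonneg_left (sq_add_rpow_le hz0 hε (by linarith)) zero_le_two)
      (Real.sqrt_le_sqrt (by linarith)) (Real.sqrt_nonneg _) (by positivity)
  have h4 : |radialPrim n (‖z‖ ^ 2 + ε)| ≤ |radialPrim n ((2 * s) ^ 2 + 1)| +
      |radialPrim n (‖z‖ ^ 2 + ε) - radialPrim n ((2 * s) ^ 2 + 1)| := by
    linarith [abs_sub_abs_le_abs_sub (radialPrim n (‖z‖ ^ 2 + ε)) (radialPrim n ((2 * s) ^ 2 + 1))]
  rw [abs_of_nonneg h1] at h4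
  rw [primBound]
  linarith

lemma abs_kGrad_newton_le (hn : 1 ≤ n) {z : Esp n} (hz0 : z ≠ 0) {ε : ℝ} (hε : 0 ≤ ε)
    (l : Fin n) : |kGrad 1 (‖z‖ ^ 2 + ε) 0 z l| ≤ 2 * ‖z‖ ^ (1 - (n : ℝ)) := by
  have hn' : (1 : ℝ) ≤ n := by exact_mod_cast hn
  refine (abs_kGrad_le (sq_add_pos hz0 hε) (by rw [sum_sq_sub_zero]; linarith) l).trans ?_
  exact mul_le_mul_of_nonneg_left (sq_add_rpow_le hz0 hε (by linarith)) zero_le_two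

lemma abs_kHess_newton_le {z : Esp n} (hz0 : z ≠ 0) {ε : ℝ} (hε : 0 ≤ ε)
    (κ l : Fin n) : |kHess 1 (‖z‖ ^ 2 + ε) 0 z κ l| ≤ (2 * n + 2) * ‖z‖ ^ (-(n : ℝ)) := by
  refine (abs_kHess_le (sq_add_pos hz0 hε) zero_le_one le_rfl
    (by rw [sum_sq_sub_zero]; linarith) κ l).trans ?_
  rw [← neg_div]
  exact mul_le_mul_of_nonneg_left (sq_add_rpow_le hz0 hε (by simp)) (by positivity)

lemma measurable_kGrad_newton (ε : ℝ) (l : Fin n) :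
    Measurable fun z : Esp n => kGrad 1 (‖z‖ ^ 2 + ε) 0 z l := by
  unfold kGrad
  fun_prop

lemma measurable_kHess_newton (ε : ℝ) (κ l : Fin n) :
    Measurable fun z : Esp n => kHess 1 (‖z‖ ^ 2 + ε) 0 z κ l := by
  unfold kHess
  split_ifs <;> fun_prop

lemma tendsto_kGrad_newton {z : Esp n} (hz : z ≠ 0) (l : Fin n) :
    Tendsto (fun j => kGrad 1 (‖z‖ ^ 2 + regSeq j) 0 z l) atTop
      (𝓝 (kGrad 1 (‖z‖ ^ 2 + 0) 0 z l)) := by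
  have h := (tendsto_sq_add_regSeq z).rpow_const (p := -((n : ℝ) / 2))
    (Or.inl (sq_add_pos hz le_rfl).ne')
  unfold kGrad
  exact (h.const_mul _).mul_const _

lemma tendsto_kHess_newton {z : Esp n} (hz : z ≠ 0) (κ l : Fin n) :
    Tendsto (fun j => kHess 1 (‖z‖ ^ 2 + regSeq j) 0 z κ l) atTop
      (𝓝 (kHess 1 (‖z‖ ^ 2 + 0) 0 z κ l)) := by
  have h := fun p : ℝ => (tendsto_sq_add_regSeq z).rpow_const (p := p)
    (Or.inl (sq_add_pos hz le_rfl).ne')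
  unfold kHess
  refine ((((h _).const_mul _).mul_const _).mul_const _).sub ?_
  split_ifs
  · exact (h _).const_mul _
  · exact tendsto_const_nhds

lemma integrableOn_kHess_newton {ε : ℝ} (hε : 0 < ε) (κ l : Fin n) (R : ℝ) :
    IntegrableOn (fun z : Esp n => kHess 1 (‖z‖ ^ 2 + ε) 0 z κ l) (ball 0 R) := by
  have h : ∀ p : ℝ, Continuous fun z : Esp n => (‖z‖ ^ 2 + ε) ^ p := fun p =>
    (by fun_prop : Continuous fun z : Esp n => ‖z‖ ^ 2 + ε).rpow_const
      fun z => Or.inl (by positivity)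
  have hc : Continuous fun z : Esp n => kHess 1 (‖z‖ ^ 2 + ε) 0 z κ l := by
    unfold kHess
    refine ((((h _).const_mul _).mul (by fun_prop)).mul (by fun_prop)).sub ?_
    split_ifs
    · exact (h _).const_mul _
    · exact continuous_const
  exact (hc.continuousOn.integrableOn_compact (isCompact_closedBall 0 R)).mono_set
    ball_subset_closedBall

lemma integral_kHess_self {ε : ℝ} (hε : 0 < ε) (κ : Fin n) (R : ℝ) :
    ∫ z in ball (0 : Esp n) R, kHess 1 (‖z‖ ^ 2 + ε) 0 z κ κ =
      -2 * ∫ z in ball (0 : Esp n) R, ε * (‖z‖ ^ 2 + ε) ^ (-((n : ℝ) / 2) - 1) := by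
  have h1 : ∑ l : Fin n, ∫ z in ball (0 : Esp n) R, kHess 1 (‖z‖ ^ 2 + ε) 0 z l l =
      ∫ z in ball (0 : Esp n) R, -2 * n * (ε * (‖z‖ ^ 2 + ε) ^ (-((n : ℝ) / 2) - 1)) := by
    rw [← integral_finsetSum _ fun l _ => integrableOn_kHess_newton hε l l R]
    congr 1
    ext z
    rw [sum_kHess (δ := ε) (by positivity) (by rw [sum_sq_sub_zero]; ring)]
    ring
  rw [Finset.sum_congr rfl fun l _ => integral_kHess_self_eq l κ R ε, Finset.sum_const,
    Finset.card_univ, Fintype.card_fin, nsmul_eq_mul, integral_const_mul] at h1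
  have hn : (n : ℝ) ≠ 0 := by
    have := κ.pos
    positivity
  refine mul_left_cancel₀ hn (h1.trans ?_)
  ring

lemma tendsto_integral_kHess (κ l : Fin n) {R : ℝ} (hR : 0 < R) :
    Tendsto (fun j => ∫ z in ball (0 : Esp n) R, kHess 1 (‖z‖ ^ 2 + regSeq j) 0 z κ l) atTop
      (𝓝 (if κ = l then -2 * poissonMass n else 0)) := by
  split_ifs with h
  · subst h
    simp only [integral_kHess_self (regSeq_pos _)]
    exact (tendsto_poissonMass hR).const_mul _
  · simp only [integral_kHess_of_ne h]
    exact tendsto_const_nhds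

/-- The Newton potential, up to normalization. -/
def newtPot (s : ℝ) (f : Esp n → ℝ) (x : Esp n) : ℝ :=
  ∫ y in ball (0 : Esp n) s, radialPrim n (‖x - y‖ ^ 2) * f y

/-- The gradient of the Newton potential. -/
def newtGrad (s : ℝ) (f : Esp n → ℝ) (l : Fin n) (x : Esp n) : ℝ :=
  ∫ y in ball (0 : Esp n) s, kGrad 1 (‖x - y‖ ^ 2) 0 (x - y) l * f y

/-- The Hessian of the Newton potential. -/
def newtHess (s : ℝ) (f : Esp n → ℝ) (κ l : Fin n) (x : Esp n) : ℝ :=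
  (∫ z in ball (0 : Esp n) (2 * s), kHess 1 (‖z‖ ^ 2) 0 z κ l * (f (x - z) - f x)) +
    (if κ = l then -2 * poissonMass n else 0) * f x

lemma integrableOn_radialPrim (hn : 1 ≤ n) (s : ℝ) {ε : ℝ} (hε : 0 ≤ ε) (hε1 : ε ≤ 1) :
    IntegrableOn (fun z : Esp n => radialPrim n (‖z‖ ^ 2 + ε)) (ball 0 (2 * s)) :=
  integrableOn_of_abs_le hn measurableSet_ball (integrableOn_primBound hn s)
    (aestronglyMeasurable_radialPrim hn hε _) fun _ hz hz0 => abs_radialPrim_le hn hz hz0 hε hε1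

lemma integrableOn_kGrad_newton (hn : 1 ≤ n) (R : ℝ) {ε : ℝ} (hε : 0 ≤ ε) (l : Fin n) :
    IntegrableOn (fun z : Esp n => kGrad 1 (‖z‖ ^ 2 + ε) 0 z l) (ball 0 R) :=
  integrableOn_of_abs_le hn measurableSet_ball
    ((integrableOn_norm_rpow_ball hn (by linarith : -(n : ℝ) < 1 - n) R).const_mul 2)
    (measurable_kGrad_newton ε l).aestronglyMeasurable
    fun _ _ hz0 => abs_kGrad_newton_le hn hz0 hε l

lemma tendsto_newtPot (hn : 1 ≤ n) {s γ : ℝ} (hγ : 0 < γ) {f : Esp n → ℝ}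
    (hf : IsHolderZero s γ f) :
    TendstoUniformlyOn
      (fun j x => ∫ y in ball (0 : Esp n) s, radialPrim n (‖x - y‖ ^ 2 + regSeq j) * f y)
      (newtPot s f) atTop (ball 0 s) := by
  obtain ⟨M, hM⟩ := hf.bounded hγ
  have h := tendstoUniformlyOn_convolution (s := s)
    (k := fun ε z => radialPrim n (‖z‖ ^ 2 + ε)) hM (hf.continuous hγ)
    (fun ε hε hε1 => integrableOn_radialPrim hn s hε hε1)
    (tendsto_integral_abs_sub hn measurableSet_ball (integrableOn_primBound hn s)
      (fun ε hε => aestronglyMeasurable_radialPrim hn hε _)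
      (fun ε hε hε1 z hz hz0 => abs_radialPrim_le hn hz hz0 hε hε1)
      fun z hz => ((hasDerivAt_radialPrim n (sq_add_pos hz le_rfl)).continuousAt.tendsto).comp
        (tendsto_sq_add_regSeq z))
  simp only [add_zero] at h
  exact h

lemma tendsto_newtGrad (hn : 1 ≤ n) {s γ : ℝ} (hγ : 0 < γ) {f : Esp n → ℝ}
    (hf : IsHolderZero s γ f) (l : Fin n) :
    TendstoUniformlyOn
      (fun j x => ∫ y in ball (0 : Esp n) s,
        kGrad 1 (‖x - y‖ ^ 2 + regSeq j) 0 (x - y) l * f y)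
      (newtGrad s f l) atTop (ball 0 s) := by
  obtain ⟨M, hM⟩ := hf.bounded hγ
  have h := tendstoUniformlyOn_convolution (s := s)
    (k := fun ε z => kGrad 1 (‖z‖ ^ 2 + ε) 0 z l) hM (hf.continuous hγ)
    (fun ε hε hε1 => integrableOn_kGrad_newton hn _ hε l)
    (tendsto_integral_abs_sub hn measurableSet_ball
      ((integrableOn_norm_rpow_ball hn (by linarith : -(n : ℝ) < 1 - n) _).const_mul 2)
      (fun ε _ => (measurable_kGrad_newton ε l).aestronglyMeasurable)
      (fun ε hε _ z _ hz0 => abs_kGrad_newton_le hn hz0 hε l)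
      fun z hz => tendsto_kGrad_newton hz l)
  simp only [add_zero] at h
  exact h

lemma abs_kHess_mul_rpow_le {z : Esp n} (hz0 : z ≠ 0) {ε : ℝ} (hε : 0 ≤ ε) (γ : ℝ)
    (κ l : Fin n) :
    |kHess 1 (‖z‖ ^ 2 + ε) 0 z κ l * ‖z‖ ^ γ| ≤ (2 * n + 2) * ‖z‖ ^ (γ - (n : ℝ)) := by
  rw [abs_mul, abs_of_nonneg (Real.rpow_nonneg (norm_nonneg z) _), sub_eq_neg_add,
    Real.rpow_add (norm_pos_iff.2 hz0), ← mul_assoc]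
  exact mul_le_mul_of_nonneg_right (abs_kHess_newton_le hz0 hε κ l)
    (Real.rpow_nonneg (norm_nonneg z) _)

lemma integrableOn_kHess_mul_rpow (hn : 1 ≤ n) {γ : ℝ} (hγ : 0 < γ) (R : ℝ) {ε : ℝ}
    (hε : 0 ≤ ε) (κ l : Fin n) :
    IntegrableOn (fun z : Esp n => kHess 1 (‖z‖ ^ 2 + ε) 0 z κ l * ‖z‖ ^ γ) (ball 0 R) :=
  integrableOn_of_abs_le hn measurableSet_ball
    ((integrableOn_norm_rpow_ball hn (by linarith : -(n : ℝ) < γ - n) R).const_mul (2 * n + 2))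
    ((measurable_kHess_newton ε κ l).mul (by fun_prop)).aestronglyMeasurable
    fun _ _ hz0 => abs_kHess_mul_rpow_le hz0 hε γ κ l

lemma abs_mul_sub_le {γ C : ℝ} {f : Esp n → ℝ} (hC : ∀ x y, |f x - f y| ≤ C * ‖x - y‖ ^ γ)
    (a : ℝ) (x z : Esp n) : |a * (f (x - z) - f x)| ≤ C * |a * ‖z‖ ^ γ| := by
  have h := hC (x - z) x
  rw [sub_sub_cancel_left, norm_neg] at h
  rw [abs_mul, abs_mul, abs_of_nonneg (Real.rpow_nonneg (norm_nonneg z) _)]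
  nlinarith [abs_nonneg a]

lemma integrableOn_kHess_mul_sub (hn : 1 ≤ n) {γ C : ℝ} (hγ : 0 < γ) {f : Esp n → ℝ}
    (hC : ∀ x y, |f x - f y| ≤ C * ‖x - y‖ ^ γ) (hf : Continuous f) (R : ℝ) {ε : ℝ}
    (hε : 0 ≤ ε) (κ l : Fin n) (x : Esp n) :
    IntegrableOn (fun z : Esp n => kHess 1 (‖z‖ ^ 2 + ε) 0 z κ l * (f (x - z) - f x))
      (ball 0 R) := by
  refine Integrable.mono' ((integrableOn_kHess_mul_rpow hn hγ R hε κ l).abs.const_mul C)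
    ((measurable_kHess_newton ε κ l).mul (by fun_prop)).aestronglyMeasurable ?_
  exact Filter.Eventually.of_forall fun z => abs_mul_sub_le hC _ x z

lemma tendsto_newtHess (hn : 1 ≤ n) {s γ : ℝ} (hs : 0 < s) (hγ : 0 < γ) {f : Esp n → ℝ}
    (hf : IsHolderZero s γ f) (κ l : Fin n) :
    TendstoUniformlyOn
      (fun j x => ∫ y in ball (0 : Esp n) s,
        kHess 1 (‖x - y‖ ^ 2 + regSeq j) 0 (x - y) κ l * f y)
      (newtHess s f κ l) atTop (ball 0 s) := by
  obtain ⟨M, hM⟩ := hf.bounded hγ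
  obtain ⟨⟨C, hC0, hC⟩, hz⟩ := id hf
  have hfc := hf.continuous hγ
  have h1 : Tendsto (fun j => ∫ z in ball (0 : Esp n) (2 * s),
      |kHess 1 (‖z‖ ^ 2 + regSeq j) 0 z κ l * ‖z‖ ^ γ -
        kHess 1 (‖z‖ ^ 2 + 0) 0 z κ l * ‖z‖ ^ γ|) atTop (𝓝 0) :=
    tendsto_integral_abs_sub (k := fun ε z => kHess 1 (‖z‖ ^ 2 + ε) 0 z κ l * ‖z‖ ^ γ) hn
      measurableSet_ball
      ((integrableOn_norm_rpow_ball hn (by linarith : -(n : ℝ) < γ - n) _).const_mul (2 * n + 2))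
      (fun ε _ => ((measurable_kHess_newton ε κ l).mul (by fun_prop)).aestronglyMeasurable)
      (fun ε hε _ z _ hz0 => abs_kHess_mul_rpow_le hz0 hε γ κ l)
      fun z hz => (tendsto_kHess_newton hz κ l).mul_const _
  have h2 := tendsto_integral_kHess κ l (R := 2 * s) (by linarith)
  rw [tendsto_iff_dist_tendsto_zero] at h2
  have h3 := (h1.const_mul C).add (h2.const_mul M)
  simp only [mul_zero, add_zero (0 : ℝ)] at h3
  rw [Metric.tendstoUniformlyOn_iff]
  intro δ hδ
  filter_upwards [h3.eventually (gt_mem_nhds hδ)] with j hj x hx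
  refine lt_of_le_of_lt ?_ hj
  have hx' : ‖x‖ ≤ s := (mem_ball_zero_iff.1 hx).le
  have hε := regSeq_pos j
  set ε := regSeq j
  set c : ℝ := if κ = l then -2 * poissonMass n else 0
  have e : ∫ y in ball (0 : Esp n) s, kHess 1 (‖x - y‖ ^ 2 + ε) 0 (x - y) κ l * f y =
      (∫ z in ball (0 : Esp n) (2 * s), kHess 1 (‖z‖ ^ 2 + ε) 0 z κ l * (f (x - z) - f x)) +
        (∫ z in ball (0 : Esp n) (2 * s), kHess 1 (‖z‖ ^ 2 + ε) 0 z κ l) * f x := by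
    rw [setIntegral_comp_sub_eq (k := fun z => kHess 1 (‖z‖ ^ 2 + ε) 0 z κ l) hz hx',
      ← integral_mul_const, ← integral_add (integrableOn_kHess_mul_sub hn hγ hC hfc _ hε.le κ l x)
        ((integrableOn_kHess_newton hε κ l _).mul_const _)]
    congr 1
    ext z
    ring
  have i0 := integrableOn_kHess_mul_sub hn hγ hC hfc (2 * s) le_rfl κ l x
  have iε := integrableOn_kHess_mul_sub hn hγ hC hfc (2 * s) hε.le κ l x
  have hA : |(∫ z in ball (0 : Esp n) (2 * s),
        kHess 1 (‖z‖ ^ 2 + ε) 0 z κ l * (f (x - z) - f x)) -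
      ∫ z in ball (0 : Esp n) (2 * s), kHess 1 (‖z‖ ^ 2 + 0) 0 z κ l * (f (x - z) - f x)| ≤
      C * ∫ z in ball (0 : Esp n) (2 * s), |kHess 1 (‖z‖ ^ 2 + ε) 0 z κ l * ‖z‖ ^ γ -
        kHess 1 (‖z‖ ^ 2 + 0) 0 z κ l * ‖z‖ ^ γ| := by
    rw [← integral_sub iε i0, ← integral_const_mul]
    simp only [← sub_mul]
    rw [← Real.norm_eq_abs]
    refine norm_integral_le_of_norm_le ?_ (Filter.Eventually.of_forall fun z =>
      abs_mul_sub_le hC _ x z)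
    simp only [sub_mul]
    exact (((integrableOn_kHess_mul_rpow hn hγ _ hε.le κ l).sub
      (integrableOn_kHess_mul_rpow hn hγ _ le_rfl κ l)).abs).const_mul C
  simp only [add_zero] at hA
  simp only [add_zero]
  rw [e, dist_comm, Real.dist_eq, newtHess, add_sub_add_comm, ← sub_mul]
  refine (abs_add_le _ _).trans (add_le_add hA ?_)
  rw [abs_mul, mul_comm, Real.dist_eq]
  exact mul_le_mul_of_nonneg_right (hM x) (abs_nonneg _)

theorem hasC2Data_newtPot (hn : 1 ≤ n) {s γ : ℝ} (hs : 0 < s) (hγ : 0 < γ) {f : Esp n → ℝ}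
    (hf : IsHolderZero s γ f) :
    HasC2Data (ball 0 s) (newtPot s f) (newtGrad s f) (newtHess s f) := by
  refine HasC2Data.of_tendsto isOpen_ball (F := atTop) (fun j => ?_)
    (fun x hx => (tendsto_newtPot hn hγ hf).tendsto_at hx) (tendsto_newtGrad hn hγ hf)
    (tendsto_newtHess hn hs hγ hf)
  have h := hasC2Data_potential (r := s) (s := s) (α := fun _ => 1)
    (β := fun y : Esp n => ‖y‖ ^ 2 + regSeq j) (by fun_prop) (by fun_prop) (hf.continuous hγ)
    (fun x _ y _ => by
      rw [quadPoly_one]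
      have := regSeq_pos j
      positivity)
  simp only [quadPoly_one, kGrad, kHess] at h
  simpa only [kGrad, kHess, one_mul, PiLp.zero_apply, sub_zero, PiLp.sub_apply] using h

lemma sum_newtHess (hn : 1 ≤ n) {s γ : ℝ} (hγ : 0 < γ) {f : Esp n → ℝ}
    (hf : IsHolderZero s γ f) (x : Esp n) :
    ∑ l, newtHess s f l l x = -(2 * n * poissonMass n) * f x := by
  obtain ⟨⟨C, -, hC⟩, -⟩ := id hf
  have hi := fun l => integrableOn_kHess_mul_sub hn hγ hC (hf.continuous hγ) (2 * s) le_rfl l l x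
  simp only [add_zero] at hi
  simp only [newtHess, if_true, Finset.sum_add_distrib]
  rw [← integral_finsetSum _ fun l _ => hi l, integral_eq_zero_of_ae]
  · simp only [Finset.sum_const, Finset.card_univ, Fintype.card_fin, nsmul_eq_mul]
    ring
  · filter_upwards [ae_ne_zero_restrict hn _] with z hz
    rw [← Finset.sum_mul, sum_kHess (δ := 0) (by simpa using sq_add_pos hz le_rfl)
      (by rw [sum_sq_sub_zero]; ring)]
    simp

lemma abs_newtHess_le (hn : 1 ≤ n) {s γ C M : ℝ} (hγ : 0 < γ) (hC0 : 0 ≤ C) {f : Esp n → ℝ}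
    (hC : ∀ x y, |f x - f y| ≤ C * ‖x - y‖ ^ γ) (hM : ∀ x, |f x| ≤ M) (κ l : Fin n) (x : Esp n) :
    |newtHess s f κ l x| ≤ C * ((2 * n + 2) * rieszConst n s (γ - n)) + 2 * poissonMass n * M := by
  have hJ := poissonMass_pos n
  rw [newtHess]
  refine (abs_add_le _ _).trans (add_le_add ?_ ?_)
  · rw [rieszConst, ← integral_const_mul, ← integral_const_mul, ← Real.norm_eq_abs]
    refine norm_integral_le_of_norm_le (((integrableOn_norm_rpow_ball hn
      (by linarith : -(n : ℝ) < γ - n) _).const_mul (2 * n + 2)).const_mul C) ?_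
    filter_upwards [ae_ne_zero_restrict hn _] with z hz
    refine (abs_mul_sub_le hC _ x z).trans (mul_le_mul_of_nonneg_left ?_ hC0)
    simpa using abs_kHess_mul_rpow_le hz le_rfl γ κ l
  · rw [abs_mul]
    refine mul_le_mul ?_ (hM x) (abs_nonneg _) (by positivity)
    split_ifs
    · rw [neg_mul, abs_neg, abs_of_nonneg (by positivity)]
    · rw [abs_zero]
      positivity

lemma abs_newtGrad_le (hn : 1 ≤ n) {s M : ℝ} {f : Esp n → ℝ} (hM : ∀ x, |f x| ≤ M) (l : Fin n)
    {x : Esp n} (hx : ‖x‖ ≤ s) : |newtGrad s f l x| ≤ M * (2 * rieszConst n s (1 - n)) := by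
  have hM0 : 0 ≤ M := (abs_nonneg _).trans (hM 0)
  have hi := integrableOn_kGrad_newton hn (2 * s) le_rfl l
  simp only [add_zero] at hi
  refine (abs_convolution_le (k := fun z => kGrad 1 (‖z‖ ^ 2) 0 z l) hM hi hx).trans
    (mul_le_mul_of_nonneg_left ?_ hM0)
  rw [rieszConst, ← integral_const_mul]
  refine integral_mono_ae hi.abs
    ((integrableOn_norm_rpow_ball hn (by linarith : -(n : ℝ) < 1 - n) _).const_mul 2) ?_
  filter_upwards [ae_ne_zero_restrict hn _] with z hz
  simpa using abs_kGrad_newton_le hn hz le_rfl l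

end NewtonPotential

section Reflection

open Filter Topology

variable {n : ℕ}

lemma HasC2Data.of_local {U : Set (Esp n)} {u : Esp n → ℝ} {g : Fin n → Esp n → ℝ}
    {W : Fin n → Fin n → Esp n → ℝ}
    (h : ∀ x ∈ U, ∃ V, IsOpen V ∧ x ∈ V ∧ HasC2Data V u g W) : HasC2Data U u g W where
  grad x hx := by
    obtain ⟨V, -, hxV, hd⟩ := h x hx
    exact hd.grad x hxV
  hess l x hx := by
    obtain ⟨V, -, hxV, hd⟩ := h x hx
    exact hd.hess l x hxV
  cont κ l x hx := by
    obtain ⟨V, hV, hxV, hd⟩ := h x hx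
    exact ((hd.cont κ l).continuousAt (hV.mem_nhds hxV)).continuousWithinAt

/-- The potential of the image charges. -/
def reflPot (s : ℝ) (f : Esp n → ℝ) (x : Esp n) : ℝ :=
  ∫ y in ball (0 : Esp n) s, radialPrim n (reflSq s x y) * f y

/-- The gradient of the potential of the image charges. -/
def reflGrad (s : ℝ) (f : Esp n → ℝ) (l : Fin n) (x : Esp n) : ℝ :=
  ∫ y in ball (0 : Esp n) s, kGrad (‖y‖ ^ 2 / s ^ 2) (reflSq s x y) y x l * f y

/-- The Hessian of the potential of the image charges. -/
def reflHess (s : ℝ) (f : Esp n → ℝ) (κ l : Fin n) (x : Esp n) : ℝ :=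
  ∫ y in ball (0 : Esp n) s, kHess (‖y‖ ^ 2 / s ^ 2) (reflSq s x y) y x κ l * f y

lemma hasC2Data_reflPot {s : ℝ} (hs : 0 < s) {f : Esp n → ℝ} (hf : Continuous f) :
    HasC2Data (ball 0 s) (reflPot s f) (reflGrad s f) (reflHess s f) := by
  refine HasC2Data.of_local fun x hx => ?_
  rw [mem_ball_zero_iff] at hx
  obtain ⟨r, hr, hrs⟩ := exists_between hx
  refine ⟨ball 0 r, isOpen_ball, mem_ball_zero_iff.2 hr, ?_⟩
  exact hasC2Data_potential (α := fun y : Esp n => ‖y‖ ^ 2 / s ^ 2) (β := fun _ => s ^ 2)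
    (by fun_prop) (by fun_prop) hf fun x hx y hy =>
      reflSq_pos hs ((mem_closedBall_zero_iff.1 hx).trans_lt hrs) (mem_closedBall_zero_iff.1 hy)

lemma continuous_reflSq (s : ℝ) (x : Esp n) : Continuous (reflSq s x) := by
  unfold reflSq quadPoly
  fun_prop

lemma continuousOn_reflSq_rpow {s : ℝ} (hs : 0 < s) {x : Esp n} (hx : ‖x‖ < s) (p : ℝ) :
    ContinuousOn (fun y => reflSq s x y ^ p) (closedBall 0 s) :=
  (continuous_reflSq s x).continuousOn.rpow_const fun _ hy =>
    Or.inl (reflSq_pos hs hx (mem_closedBall_zero_iff.1 hy)).ne'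

lemma integrableOn_ball_of_continuousOn {k : Esp n → ℝ} {s : ℝ}
    (h : ContinuousOn k (closedBall 0 s)) : IntegrableOn k (ball 0 s) :=
  (h.integrableOn_compact (isCompact_closedBall _ _)).mono_set ball_subset_closedBall

lemma integrableOn_reflPot {s : ℝ} (hs : 0 < s) {x : Esp n} (hx : ‖x‖ < s) {f : Esp n → ℝ}
    (hf : Continuous f) : IntegrableOn (fun y => radialPrim n (reflSq s x y) * f y) (ball 0 s) := by
  refine integrableOn_ball_of_continuousOn (ContinuousOn.mul (fun y hy => ?_) hf.continuousOn)
  exact ContinuousAt.comp_continuousWithinAt (f := reflSq s x)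
    (hasDerivAt_radialPrim n (reflSq_pos hs hx (mem_closedBall_zero_iff.1 hy))).continuousAt
    (continuous_reflSq s x).continuousWithinAt

lemma integrableOn_reflHess {s : ℝ} (hs : 0 < s) {x : Esp n} (hx : ‖x‖ < s) {f : Esp n → ℝ}
    (hf : Continuous f) (κ l : Fin n) :
    IntegrableOn (fun y => kHess (‖y‖ ^ 2 / s ^ 2) (reflSq s x y) y x κ l * f y) (ball 0 s) := by
  refine integrableOn_ball_of_continuousOn (ContinuousOn.mul ?_ hf.continuousOn)
  have h := continuousOn_reflSq_rpow hs hx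
  unfold kHess
  refine ContinuousOn.sub (((continuousOn_const.mul (h _)).mul (by fun_prop)).mul
    (by fun_prop)) ?_
  split_ifs
  · exact ContinuousOn.mul (by fun_prop) (h _)
  · exact continuousOn_const

lemma sum_reflHess {s : ℝ} (hs : 0 < s) {x : Esp n} (hx : ‖x‖ < s) {f : Esp n → ℝ}
    (hf : Continuous f) : ∑ l, reflHess s f l l x = 0 := by
  simp only [reflHess]
  rw [← integral_finsetSum _ fun l _ => integrableOn_reflHess hs hx hf l l]
  refine integral_eq_zero_of_ae ?_
  filter_upwards [ae_restrict_mem measurableSet_ball] with y hy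
  rw [← Finset.sum_mul, sum_kHess (δ := 0)
    (reflSq_pos hs hx (mem_ball_zero_iff.1 hy).le) (by rw [sum_sq_reflSq hs]; ring)]
  simp

lemma sq_div_sq_le_one {s : ℝ} (hs : 0 < s) {y : Esp n} (hy : ‖y‖ ≤ s) :
    ‖y‖ ^ 2 / s ^ 2 ≤ 1 := by
  rw [div_le_one (by positivity)]
  exact pow_le_pow_left₀ (norm_nonneg _) hy 2

lemma sum_sq_le_reflSq {s : ℝ} (hs : 0 < s) {x y : Esp n} (hx : ‖x‖ < s) (hy : ‖y‖ ≤ s) :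
    ∑ l, (‖y‖ ^ 2 / s ^ 2 * x l - y l) ^ 2 ≤ reflSq s x y := by
  rw [sum_sq_reflSq hs]
  exact mul_le_of_le_one_left (reflSq_pos hs hx hy).le (sq_div_sq_le_one hs hy)

lemma reflSq_rpow_le {s : ℝ} (hs : 0 < s) {x y : Esp n} (hx : ‖x‖ ≤ s) (hy : ‖y‖ ≤ s)
    (hxy : x - y ≠ 0) {p : ℝ} (hp : p ≤ 0) : reflSq s x y ^ (p / 2) ≤ ‖x - y‖ ^ p := by
  rw [← sq_rpow_half (norm_nonneg (x - y))]
  exact Real.rpow_le_rpow_of_nonpos (pow_pos (norm_pos_iff.2 hxy) 2)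
    (norm_sub_sq_le_reflSq hs hx hy) (by linarith)

lemma ae_sub_ne_zero_restrict (hn : 1 ≤ n) (x : Esp n) (S : Set (Esp n)) :
    ∀ᵐ y ∂(volume.restrict S), x - y ≠ 0 := by
  have : Nonempty (Fin n) := ⟨⟨0, hn⟩⟩
  filter_upwards [ae_restrict_of_ae (Measure.ae_ne volume x)] with y hy
  exact sub_ne_zero.2 hy.symm

lemma abs_setIntegral_le_rieszConst (hn : 1 ≤ n) {s p C : ℝ} (hp : -(n : ℝ) < p) (hC : 0 ≤ C)
    {x : Esp n} (hx : ‖x‖ ≤ s) {k : Esp n → ℝ}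
    (hk : ∀ y ∈ ball (0 : Esp n) s, x - y ≠ 0 → |k y| ≤ C * ‖x - y‖ ^ p) :
    |∫ y in ball (0 : Esp n) s, k y| ≤ C * rieszConst n s p := by
  have hi := integrableOn_norm_rpow_ball hn hp (2 * s)
  have hi' := integrableOn_comp_sub_ball hi hx
  calc _ ≤ ∫ y in ball (0 : Esp n) s, C * ‖x - y‖ ^ p := by
        rw [← Real.norm_eq_abs]
        refine norm_integral_le_of_norm_le (Integrable.const_mul hi' C) ?_
        filter_upwards [ae_restrict_mem measurableSet_ball, ae_sub_ne_zero_restrict hn x _]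
          with y hy hxy
        exact hk y hy hxy
    _ ≤ _ := by
        rw [integral_const_mul]
        exact mul_le_mul_of_nonneg_left (setIntegral_comp_sub_ball_le (k := fun z => ‖z‖ ^ p)
          (fun z => Real.rpow_nonneg (norm_nonneg z) _) hi hx) hC

lemma abs_reflGrad_le (hn : 1 ≤ n) {s M : ℝ} (hs : 0 < s) {f : Esp n → ℝ}
    (hM : ∀ x, |f x| ≤ M) (l : Fin n) {x : Esp n} (hx : ‖x‖ < s) :
    |reflGrad s f l x| ≤ 2 * M * rieszConst n s (1 - n) := by
  have hn' : (1 : ℝ) ≤ n := by exact_mod_cast hn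
  have hM0 : 0 ≤ M := (abs_nonneg _).trans (hM 0)
  refine abs_setIntegral_le_rieszConst hn (by linarith) (by positivity) hx.le fun y hy hxy => ?_
  have hy' := (mem_ball_zero_iff.1 hy).le
  have h1 := abs_kGrad_le (reflSq_pos hs hx hy') (sum_sq_le_reflSq hs hx hy') l
  have h2 := reflSq_rpow_le hs hx.le hy' hxy (by linarith : 1 - (n : ℝ) ≤ 0)
  rw [abs_mul, show 2 * M * ‖x - y‖ ^ (1 - (n : ℝ)) = 2 * ‖x - y‖ ^ (1 - (n : ℝ)) * M by ring]
  exact mul_le_mul (by linarith) (hM y) (abs_nonneg _) (by positivity)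

lemma exists_norm_eq_norm_sub_eq (hn : 1 ≤ n) {s : ℝ} (hs : 0 < s) {y : Esp n} (hy : ‖y‖ ≤ s) :
    ∃ z : Esp n, ‖z‖ = s ∧ ‖y - z‖ = s - ‖y‖ := by
  rcases eq_or_ne y 0 with rfl | h
  · refine ⟨EuclideanSpace.single ⟨0, hn⟩ s, ?_, ?_⟩ <;> simp [abs_of_pos hs]
  · have h0 := norm_pos_iff.2 h
    refine ⟨(s / ‖y‖) • y, ?_, ?_⟩
    · rw [norm_smul, Real.norm_of_nonneg (by positivity), div_mul_cancel₀ _ h0.ne']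
    · have e : y - (s / ‖y‖) • y = (1 - s / ‖y‖) • y := by rw [sub_smul, one_smul]
      have h1 : 1 ≤ s / ‖y‖ := (one_le_div h0).2 hy
      rw [e, norm_smul, Real.norm_of_nonpos (by linarith), neg_mul, sub_mul,
        div_mul_cancel₀ _ h0.ne']
      ring

lemma abs_le_of_isHolder (hn : 1 ≤ n) {s γ C : ℝ} (hs : 0 < s) {f : Esp n → ℝ}
    (hC : ∀ x y, |f x - f y| ≤ C * ‖x - y‖ ^ γ) (h0 : ∀ x, s ≤ ‖x‖ → f x = 0)
    {y : Esp n} (hy : ‖y‖ ≤ s) : |f y| ≤ C * (s - ‖y‖) ^ γ := by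
  obtain ⟨z, hz, hyz⟩ := exists_norm_eq_norm_sub_eq hn hs hy
  have := hC y z
  rwa [h0 z hz.ge, sub_zero, hyz] at this

lemma abs_reflHess_le (hn : 1 ≤ n) {s γ C : ℝ} (hs : 0 < s) (hγ : 0 < γ) (hγ1 : γ < 1)
    (hC0 : 0 ≤ C) {f : Esp n → ℝ}
    (hC : ∀ x y, |f x - f y| ≤ C * ‖x - y‖ ^ γ) (h0 : ∀ x, s ≤ ‖x‖ → f x = 0)
    (κ l : Fin n) {x : Esp n} (hx : ‖x‖ < s) :
    |reflHess s f κ l x| ≤ (2 * n + 2) * C * rieszConst n s (γ - n) := by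
  have hn' : (1 : ℝ) ≤ n := by exact_mod_cast hn
  refine abs_setIntegral_le_rieszConst hn (by linarith) (by positivity) hx.le fun y hy hxy => ?_
  have hy' := (mem_ball_zero_iff.1 hy).le
  have hq := reflSq_pos hs hx hy'
  have h1 := abs_kHess_le hq (by positivity) (sq_div_sq_le_one hs hy')
    (sum_sq_le_reflSq hs hx hy') κ l
  have h2 : |f y| ≤ C * reflSq s x y ^ (γ / 2) := by
    refine (abs_le_of_isHolder hn hs hC h0 hy').trans (mul_le_mul_of_nonneg_left ?_ hC0)
    rw [← sq_rpow_half (sub_nonneg.2 hy')]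
    exact Real.rpow_le_rpow (sq_nonneg _) (sub_norm_sq_le_reflSq hs hx.le hy') (by positivity)
  have h3 := reflSq_rpow_le hs hx.le hy' hxy (by linarith : γ - (n : ℝ) ≤ 0)
  rw [abs_mul]
  calc _ ≤ ((2 * n + 2) * reflSq s x y ^ (-((n : ℝ) / 2))) * (C * reflSq s x y ^ (γ / 2)) :=
        mul_le_mul h1 h2 (abs_nonneg _) (by positivity)
    _ = (2 * n + 2) * C * reflSq s x y ^ ((γ - n) / 2) := by
        rw [show (γ - (n : ℝ)) / 2 = -((n : ℝ) / 2) + γ / 2 by ring, Real.rpow_add hq]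
        ring
    _ ≤ _ := mul_le_mul_of_nonneg_left h3 (by positivity)

end Reflection

section Regularity

open Filter Topology

variable {n : ℕ} {s : ℝ}

lemma norm_sub_le_of_hasFDerivAt_coordForm {g : Esp n → ℝ} {W : Fin n → Esp n → ℝ} {K : ℝ}
    (h : ∀ x ∈ ball (0 : Esp n) s, HasFDerivAt g (coordForm fun l => W l x) x)
    (hK : ∀ l, ∀ x ∈ ball (0 : Esp n) s, |W l x| ≤ K) {x y : Esp n}
    (hx : x ∈ ball (0 : Esp n) s) (hy : y ∈ ball (0 : Esp n) s) :
    |g x - g y| ≤ n * K * ‖x - y‖ := by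
  refine (convex_ball (0 : Esp n) s).norm_image_sub_le_of_norm_hasFDerivWithin_le
    (fun z hz => (h z hz).hasFDerivWithinAt) (fun z hz => ?_) hy hx
  refine (norm_coordForm_le _).trans ((Finset.sum_le_sum fun l _ => hK l z hz).trans_eq ?_)
  simp

lemma abs_sub_le_of_ball {u : Esp n → ℝ} {L D : ℝ} (hL0 : 0 ≤ L)
    (hL : ∀ x ∈ ball (0 : Esp n) s, ∀ y ∈ ball (0 : Esp n) s, |u x - u y| ≤ L * ‖x - y‖)
    (h0 : ∀ x, s ≤ ‖x‖ → u x = 0) (hD : ∀ x, |u x| ≤ D * √(s ^ 2 - ‖x‖ ^ 2)) (x y : Esp n) :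
    |u x - u y| ≤ L * ‖x - y‖ := by
  have key : ∀ x y : Esp n, ‖x‖ < s → s ≤ ‖y‖ → |u x - u y| ≤ L * ‖x - y‖ := by
    intro x y hx hy
    have hs : 0 < s := (norm_nonneg x).trans_lt hx
    have hcont : ContinuousOn (fun t : ℝ => ‖AffineMap.lineMap x y t‖) (Set.Icc 0 1) := by
      have : Continuous fun t : ℝ => AffineMap.lineMap x y t := AffineMap.lineMap_continuous
      exact this.norm.continuousOn
    obtain ⟨t, ⟨ht0, ht1⟩, ht⟩ := intermediate_value_Icc zero_le_one hcont
      (show s ∈ Set.Icc _ _ by simpa using ⟨hx.le, hy⟩)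
    set z := AffineMap.lineMap x y t
    have hzs : ‖z‖ = s := ht
    have hxz : ‖x - z‖ ≤ ‖x - y‖ := by
      rw [← dist_eq_norm, ← dist_eq_norm, dist_left_lineMap, Real.norm_of_nonneg ht0]
      exact mul_le_of_le_one_left dist_nonneg ht1
    have hz : z ∈ closure (ball (0 : Esp n) s) := by
      rw [closure_ball _ hs.ne', mem_closedBall_zero_iff]
      exact hzs.le
    have hmem : ∃ᶠ w in 𝓝 z, w ∈ ball (0 : Esp n) s := mem_closure_iff_frequently.1 hz
    have hlim : Tendsto (fun w => L * ‖x - w‖ + D * √(s ^ 2 - ‖w‖ ^ 2)) (𝓝 z)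
        (𝓝 (L * ‖x - z‖ + D * √(s ^ 2 - ‖z‖ ^ 2))) := by
      refine Continuous.tendsto ?_ z
      fun_prop
    have hux : |u x| ≤ L * ‖x - z‖ + D * √(s ^ 2 - ‖z‖ ^ 2) := by
      refine ge_of_tendsto_of_frequently hlim (hmem.mono fun w hw => ?_)
      have h1 := hL x (mem_ball_zero_iff.2 hx) w hw
      have h2 := hD w
      have h3 := abs_sub_abs_le_abs_sub (u x) (u w)
      linarith
    rw [hzs, sub_self, Real.sqrt_zero, mul_zero, add_zero] at hux
    rw [h0 y hy, sub_zero]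
    exact hux.trans (mul_le_mul_of_nonneg_left hxz hL0)
  rcases lt_or_ge ‖x‖ s with hx | hx <;> rcases lt_or_ge ‖y‖ s with hy | hy
  · exact hL x (mem_ball_zero_iff.2 hx) y (mem_ball_zero_iff.2 hy)
  · exact key x y hx hy
  · rw [abs_sub_comm, norm_sub_rev]
    exact key y x hy hx
  · rw [h0 x hx, h0 y hy, sub_self, abs_zero]
    positivity

lemma isHolderZero_of_lipschitz (hn : 1 ≤ n) (hs : 0 < s) {γ : ℝ} (hγ0 : 0 < γ) (hγ1 : γ < 1)
    {u : Esp n → ℝ} {L : ℝ} (hL0 : 0 ≤ L) (hL : ∀ x y, |u x - u y| ≤ L * ‖x - y‖)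
    (h0 : ∀ x, s ≤ ‖x‖ → u x = 0) : IsHolderZero s γ u := by
  have hM : ∀ x, |u x| ≤ L * s := fun x => by
    rcases le_total ‖x‖ s with hx | hx
    · have := abs_le_of_isHolder hn hs (γ := 1) (by simpa using hL) h0 hx
      rw [Real.rpow_one] at this
      nlinarith [norm_nonneg x]
    · rw [h0 x hx, abs_zero]
      positivity
  refine ⟨⟨L + 2 * (L * s), by positivity, fun x y => ?_⟩, h0⟩
  have hg : 0 ≤ ‖x - y‖ ^ γ := Real.rpow_nonneg (norm_nonneg _) _
  have hLs : 0 ≤ L * s := by positivity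
  rcases le_total ‖x - y‖ 1 with h | h
  · have : ‖x - y‖ ≤ ‖x - y‖ ^ γ :=
      Real.self_le_rpow_of_le_one (norm_nonneg _) h hγ1.le
    nlinarith [hL x y]
  · have h1 : 1 ≤ ‖x - y‖ ^ γ := Real.one_le_rpow h hγ0.le
    have := (abs_sub (u x) (u y)).trans (add_le_add (hM x) (hM y))
    nlinarith

lemma regular_ball {u : Esp n → ℝ} {g : Fin n → Esp n → ℝ} {W : Fin n → Fin n → Esp n → ℝ}
    {K : ℝ} (h : HasC2Data (ball 0 s) u g W) (hu : Continuous u)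
    (hK : ∀ κ l, ∀ x ∈ ball (0 : Esp n) s, |W κ l x| ≤ K) : Regular (ball 0 s) u := by
  refine ⟨h.contDiffOn isOpen_ball, ?_, K, fun x hx κ l => ?_⟩
  · have hlip : ∀ l, LipschitzOnWith (n * K).toNNReal (g l) (ball 0 s) := fun l =>
      LipschitzOnWith.of_dist_le_mul fun x hx y hy => by
        rw [Real.dist_eq, dist_eq_norm]
        refine (norm_sub_le_of_hasFDerivAt_coordForm (h.hess l) (fun κ => hK κ l) hx hy).trans ?_
        exact mul_le_mul_of_nonneg_right (Real.le_coe_toNNReal _) (norm_nonneg _)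
    choose G hG hGg using fun l => (hlip l).extend_real
    have hGc : Continuous fun x => coordForm fun l => G l x := by
      rw [← continuousOn_univ]
      exact continuousOn_coordForm fun l => (hG l).continuous.continuousOn
    have hfd : ∀ x ∈ ball (0 : Esp n) s, HasFDerivAt u (coordForm fun l => G l x) x := by
      intro x hx
      have := h.grad x hx
      rwa [funext fun l => hGg l hx] at this
    have hcl : ∀ x ∈ closure (ball (0 : Esp n) s),
        HasFDerivWithinAt u (coordForm fun l => G l x) (closure (ball 0 s)) x := by
      intro x hx
      refine hasFDerivWithinAt_closure_of_tendsto_fderiv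
        (fun y hy => (hfd y hy).differentiableAt.differentiableWithinAt)
        (convex_ball _ _) isOpen_ball (fun y _ => hu.continuousWithinAt) ?_
      refine (hGc.continuousWithinAt (s := ball 0 s) (x := x)).tendsto.congr' ?_
      filter_upwards [self_mem_nhdsWithin] with y hy
      exact (hfd y hy).fderiv.symm
    rw [← zero_add (1 : WithTop ℕ∞), contDiffOn_succ_iff_hasFDerivWithinAt (by simp)]
    intro x hx
    refine ⟨closure (ball 0 s), ?_, by simp, fun x => coordForm fun l => G l x, hcl, ?_⟩
    · rw [Set.insert_eq_of_mem hx]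
      exact self_mem_nhdsWithin
    · rw [contDiffOn_zero]
      exact hGc.continuousOn
  · rw [h.pderiv2_eq isOpen_ball hx]
    exact hK κ l x hx

end Regularity

section GreenOperator

open Filter Topology

variable {n : ℕ} {s γ : ℝ}

/-- A multiple of the Green function of the ball of radius `s`. -/
def greenKer (s : ℝ) (x y : Esp n) : ℝ :=
  radialPrim n (‖x - y‖ ^ 2) - radialPrim n (reflSq s x y)

/-- The solution operator of the Dirichlet problem `-Δ u = f` in the ball of radius `s`. -/
def greenOp (s : ℝ) (f : Esp n → ℝ) (x : Esp n) : ℝ :=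
  if ‖x‖ < s then (2 * n * poissonMass n)⁻¹ * ∫ y in ball (0 : Esp n) s, greenKer s x y * f y
  else 0

lemma greenOp_of_le {x : Esp n} (hx : s ≤ ‖x‖) (f : Esp n → ℝ) : greenOp s f x = 0 :=
  if_neg hx.not_gt

lemma greenOp_of_lt {x : Esp n} (hx : ‖x‖ < s) (f : Esp n → ℝ) :
    greenOp s f x =
      (2 * n * poissonMass n)⁻¹ * ∫ y in ball (0 : Esp n) s, greenKer s x y * f y :=
  if_pos hx

lemma greenConst_pos (hn : 1 ≤ n) : 0 < (2 * n * poissonMass n)⁻¹ := by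
  have := poissonMass_pos n
  have : (0 : ℝ) < n := by exact_mod_cast hn
  positivity

lemma integrableOn_newtPot (hn : 1 ≤ n) (hγ : 0 < γ) {f : Esp n → ℝ} (hf : IsHolderZero s γ f)
    {x : Esp n} (hx : ‖x‖ ≤ s) :
    IntegrableOn (fun y => radialPrim n (‖x - y‖ ^ 2) * f y) (ball 0 s) := by
  obtain ⟨M, hM⟩ := hf.bounded hγ
  have hi := integrableOn_radialPrim hn s le_rfl zero_le_one
  simp only [add_zero] at hi
  exact integrableOn_convolution (k := fun z => radialPrim n (‖z‖ ^ 2)) hM (hf.continuous hγ) hi hx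

lemma integrableOn_greenKer_mul (hn : 1 ≤ n) (hs : 0 < s) (hγ : 0 < γ) {f : Esp n → ℝ}
    (hf : IsHolderZero s γ f) {x : Esp n} (hx : ‖x‖ < s) :
    IntegrableOn (fun y => greenKer s x y * f y) (ball 0 s) := by
  simp only [greenKer, sub_mul]
  exact (integrableOn_newtPot hn hγ hf hx.le).sub
    (integrableOn_reflPot hs hx (hf.continuous hγ))

lemma greenOp_eq (hn : 1 ≤ n) (hs : 0 < s) (hγ : 0 < γ) {f : Esp n → ℝ}
    (hf : IsHolderZero s γ f) {x : Esp n} (hx : ‖x‖ < s) :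
    greenOp s f x = (2 * n * poissonMass n)⁻¹ * (newtPot s f x - reflPot s f x) := by
  rw [greenOp_of_lt hx]
  simp only [greenKer, sub_mul]
  rw [integral_sub (integrableOn_newtPot hn hγ hf hx.le)
    (integrableOn_reflPot hs hx (hf.continuous hγ))]
  rfl

lemma hasC2Data_greenOp (hn : 1 ≤ n) (hs : 0 < s) (hγ : 0 < γ) {f : Esp n → ℝ}
    (hf : IsHolderZero s γ f) :
    HasC2Data (ball 0 s) (greenOp s f)
      (fun l x => (2 * n * poissonMass n)⁻¹ * (newtGrad s f l x - reflGrad s f l x))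
      (fun κ l x => (2 * n * poissonMass n)⁻¹ * (newtHess s f κ l x - reflHess s f κ l x)) :=
  (((hasC2Data_newtPot hn hs hγ hf).sub
    (hasC2Data_reflPot hs (hf.continuous hγ))).const_mul _).congr isOpen_ball fun _ hx =>
      greenOp_eq hn hs hγ hf (mem_ball_zero_iff.1 hx)

lemma neg_lapl_greenOp (hn : 1 ≤ n) (hs : 0 < s) (hγ : 0 < γ) {f : Esp n → ℝ}
    (hf : IsHolderZero s γ f) {x : Esp n} (hx : x ∈ ball (0 : Esp n) s) :
    -lapl (greenOp s f) x = f x := by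
  have hc := greenConst_pos hn
  simp only [lapl, (hasC2Data_greenOp hn hs hγ hf).pderiv2_eq isOpen_ball hx]
  rw [← Finset.mul_sum, Finset.sum_sub_distrib, sum_newtHess hn hγ hf,
    sum_reflHess hs (mem_ball_zero_iff.1 hx) (hf.continuous hγ)]
  rw [sub_zero, neg_mul, mul_neg, neg_neg, inv_mul_cancel_left₀ (inv_pos.1 hc).ne']

lemma greenKer_nonneg (hs : 0 < s) {x y : Esp n} (hx : ‖x‖ ≤ s) (hy : ‖y‖ ≤ s)
    (hxy : x - y ≠ 0) : 0 ≤ greenKer s x y :=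
  radialPrim_sub_nonneg (pow_pos (norm_pos_iff.2 hxy) 2) (norm_sub_sq_le_reflSq hs hx hy)

lemma greenKer_le (hn : 1 ≤ n) (hs : 0 < s) {x y : Esp n} (hx : ‖x‖ ≤ s) (hy : ‖y‖ ≤ s)
    (hxy : x - y ≠ 0) :
    greenKer s x y ≤ 2 * √(s ^ 2 - ‖x‖ ^ 2) * ‖x - y‖ ^ (1 - (n : ℝ)) := by
  refine (radialPrim_sub_le hn (pow_pos (norm_pos_iff.2 hxy) 2)
    (norm_sub_sq_le_reflSq hs hx hy)).trans ?_
  have h1 : 0 ≤ s ^ 2 - ‖x‖ ^ 2 := sub_nonneg.2 (pow_le_pow_left₀ (norm_nonneg _) hx 2)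
  have h2 : reflSq s x y - ‖x - y‖ ^ 2 ≤ s ^ 2 - ‖x‖ ^ 2 := by
    rw [reflSq_eq hs, add_sub_cancel_left, div_le_iff₀ (by positivity)]
    exact mul_le_mul_of_nonneg_left (by linarith [sq_nonneg ‖y‖]) h1
  rw [sq_rpow_half (norm_nonneg _), mul_right_comm]
  exact mul_le_mul_of_nonneg_right
    (mul_le_mul_of_nonneg_left (Real.sqrt_le_sqrt h2) zero_le_two)
    (Real.rpow_nonneg (norm_nonneg _) _)

lemma le_greenKer (hs : 0 < s) {x y : Esp n} (hx : ‖x‖ < s) (hy : ‖y‖ ≤ s)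
    (hxy : x - y ≠ 0) :
    (s - ‖x‖) * ((s ^ 2 - ‖y‖ ^ 2) / s * ((2 * s) ^ 2) ^ (-((n : ℝ) / 2))) ≤ greenKer s x y := by
  refine le_trans ?_ (le_radialPrim_sub (pow_pos (norm_pos_iff.2 hxy) 2)
    (norm_sub_sq_le_reflSq hs hx.le hy))
  have h1 : ((2 * s) ^ 2) ^ (-((n : ℝ) / 2)) ≤ reflSq s x y ^ (-((n : ℝ) / 2)) :=
    Real.rpow_le_rpow_of_nonpos (reflSq_pos hs hx hy) (reflSq_le hs hx.le hy)
      (neg_nonpos.2 (by positivity))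
  have h2 : 0 ≤ s ^ 2 - ‖y‖ ^ 2 := sub_nonneg.2 (pow_le_pow_left₀ (norm_nonneg _) hy 2)
  have h3 : 0 ≤ s - ‖x‖ := by linarith
  have h4 : (s - ‖x‖) * ((s ^ 2 - ‖y‖ ^ 2) / s) ≤ reflSq s x y - ‖x - y‖ ^ 2 := by
    rw [reflSq_eq hs, add_sub_cancel_left, mul_div_assoc', div_le_div_iff₀ hs (by positivity)]
    have h5 : (s - ‖x‖) * s ≤ s ^ 2 - ‖x‖ ^ 2 := by nlinarith [norm_nonneg x]
    calc _ = (s - ‖x‖) * s * ((s ^ 2 - ‖y‖ ^ 2) * s) := by ring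
      _ ≤ (s ^ 2 - ‖x‖ ^ 2) * ((s ^ 2 - ‖y‖ ^ 2) * s) :=
        mul_le_mul_of_nonneg_right h5 (by positivity)
      _ = _ := by ring
  rw [← mul_assoc]
  exact mul_le_mul h4 h1 (by positivity) (le_trans (by positivity) h4)

lemma abs_greenOp_le (hn : 1 ≤ n) (hs : 0 < s) {M : ℝ} {f : Esp n → ℝ} (hM : ∀ x, |f x| ≤ M)
    (x : Esp n) :
    |greenOp s f x| ≤ (2 * n * poissonMass n)⁻¹ * (2 * M * rieszConst n s (1 - n)) *
      √(s ^ 2 - ‖x‖ ^ 2) := by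
  have hM0 : 0 ≤ M := (abs_nonneg _).trans (hM 0)
  have hc := greenConst_pos hn
  have hR := rieszConst_nonneg n s (1 - n)
  rcases lt_or_ge ‖x‖ s with hx | hx
  · rw [greenOp_of_lt hx, abs_mul, abs_of_pos hc, mul_assoc (_⁻¹ : ℝ)]
    refine mul_le_mul_of_nonneg_left ?_ hc.le
    rw [show 2 * M * rieszConst n s (1 - n) * √(s ^ 2 - ‖x‖ ^ 2) =
      2 * √(s ^ 2 - ‖x‖ ^ 2) * M * rieszConst n s (1 - n) by ring]
    refine abs_setIntegral_le_rieszConst hn (by linarith) (by positivity) hx.le fun y hy hxy => ?_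
    have hy' := (mem_ball_zero_iff.1 hy).le
    rw [abs_mul, abs_of_nonneg (greenKer_nonneg hs hx.le hy' hxy), mul_right_comm]
    exact mul_le_mul (greenKer_le hn hs hx.le hy' hxy) (hM y) (abs_nonneg _) (by positivity)
  · rw [greenOp_of_le hx, abs_zero]
    positivity

/-- The Lipschitz constant of `greenOp` as a map from `L^∞` to Lipschitz functions. -/
def greenLip (n : ℕ) (s : ℝ) : ℝ :=
  n * ((2 * n * poissonMass n)⁻¹ * (4 * rieszConst n s (1 - n)))

lemma greenLip_nonneg (n : ℕ) (s : ℝ) : 0 ≤ greenLip n s := by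
  have := poissonMass_pos n
  have := rieszConst_nonneg n s (1 - n)
  unfold greenLip
  positivity

lemma greenOp_lipschitz (hn : 1 ≤ n) (hs : 0 < s) (hγ : 0 < γ) {f : Esp n → ℝ}
    (hf : IsHolderZero s γ f) {M : ℝ} (hM : ∀ x, |f x| ≤ M) (x y : Esp n) :
    |greenOp s f x - greenOp s f y| ≤ greenLip n s * M * ‖x - y‖ := by
  have hM0 : 0 ≤ M := (abs_nonneg _).trans (hM 0)
  have hL := greenLip_nonneg n s
  have hc := greenConst_pos hn
  refine abs_sub_le_of_ball (s := s) (by positivity) (fun x hx y hy => ?_)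
    (fun x hx => greenOp_of_le hx f) (abs_greenOp_le hn hs hM) x y
  refine (norm_sub_le_of_hasFDerivAt_coordForm (hasC2Data_greenOp hn hs hγ hf).grad
    (K := (2 * n * poissonMass n)⁻¹ * (4 * M * rieszConst n s (1 - n))) (fun l z hz => ?_)
    hx hy).trans_eq ?_
  · rw [abs_mul, abs_of_pos hc]
    refine mul_le_mul_of_nonneg_left ?_ hc.le
    rw [mem_ball_zero_iff] at hz
    have h1 := abs_newtGrad_le hn hM l hz.le
    have h2 := abs_reflGrad_le hn hs hM l hz
    linarith [abs_sub (newtGrad s f l z) (reflGrad s f l z)]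
  · rw [greenLip]
    ring

lemma isHolderZero_greenOp (hn : 1 ≤ n) (hs : 0 < s) (hγ : 0 < γ) (hγ1 : γ < 1)
    {f : Esp n → ℝ} (hf : IsHolderZero s γ f) : IsHolderZero s γ (greenOp s f) := by
  obtain ⟨M, hM⟩ := hf.bounded hγ
  have hM0 : 0 ≤ M := (abs_nonneg _).trans (hM 0)
  exact isHolderZero_of_lipschitz hn hs hγ hγ1 (mul_nonneg (greenLip_nonneg n s) hM0)
    (greenOp_lipschitz hn hs hγ hf hM) fun x hx => greenOp_of_le hx f

lemma regular_greenOp (hn : 1 ≤ n) (hs : 0 < s) (hγ : 0 < γ) (hγ1 : γ < 1)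
    {f : Esp n → ℝ} (hf : IsHolderZero s γ f) : Regular (ball 0 s) (greenOp s f) := by
  obtain ⟨M, hM⟩ := hf.bounded hγ
  obtain ⟨⟨C, hC0, hC⟩, hz⟩ := id hf
  refine regular_ball (hasC2Data_greenOp hn hs hγ hf)
    ((isHolderZero_greenOp hn hs hγ hγ1 hf).continuous hγ)
    (K := (2 * n * poissonMass n)⁻¹ * ((C * ((2 * n + 2) * rieszConst n s (γ - n)) +
      2 * poissonMass n * M) + (2 * n + 2) * C * rieszConst n s (γ - n))) fun κ l x hx => ?_
  have hc := greenConst_pos hn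
  rw [abs_mul, abs_of_pos hc]
  refine mul_le_mul_of_nonneg_left ?_ hc.le
  exact (abs_sub _ _).trans (add_le_add (abs_newtHess_le hn hγ hC0 hC hM κ l x)
    (abs_reflHess_le hn hs hγ hγ1 hC0 hC hz κ l (mem_ball_zero_iff.1 hx)))

lemma greenOp_sub_const_mul (hn : 1 ≤ n) (hs : 0 < s) (hγ : 0 < γ) {f g : Esp n → ℝ}
    (hf : IsHolderZero s γ f) (hg : IsHolderZero s γ g) (r : ℝ) :
    greenOp s (fun x => f x - r * g x) = fun x => greenOp s f x - r * greenOp s g x := by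
  ext x
  rcases lt_or_ge ‖x‖ s with hx | hx
  · rw [greenOp_of_lt hx, greenOp_of_lt hx, greenOp_of_lt hx, mul_left_comm r, ← mul_sub,
      ← integral_const_mul r, ← integral_sub (integrableOn_greenKer_mul hn hs hγ hf hx)
        ((integrableOn_greenKer_mul hn hs hγ hg hx).const_mul r)]
    congr 2
    ext y
    ring
  · simp only [greenOp_of_le hx, mul_zero, sub_zero]

lemma exists_le_greenOp (hn : 1 ≤ n) (hs : 0 < s) (hγ : 0 < γ) {f : Esp n → ℝ}
    (hf : IsHolderZero s γ f) (hf0 : ∀ x, 0 ≤ f x) {x₀ : Esp n} (hx₀ : 0 < f x₀) :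
    ∃ c, 0 < c ∧ ∀ x, ‖x‖ < s → c * (s - ‖x‖) ≤ greenOp s f x := by
  have hc := greenConst_pos hn
  have hfc := hf.continuous hγ
  have hd : 0 < ((2 * s) ^ 2) ^ (-((n : ℝ) / 2)) := Real.rpow_pos_of_pos (by positivity) _
  set d : ℝ := ((2 * s) ^ 2) ^ (-((n : ℝ) / 2))
  have hx₀s : ‖x₀‖ < s := by
    by_contra! h
    exact hx₀.ne' (hf.2 x₀ h)
  have hcw : Continuous fun y : Esp n => (s ^ 2 - ‖y‖ ^ 2) / s * d * f y := by fun_prop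
  have hpos : ∀ y : Esp n, ‖y‖ < s → 0 < (s ^ 2 - ‖y‖ ^ 2) / s * d := fun y hy => by
    have : 0 < s ^ 2 - ‖y‖ ^ 2 := sub_pos.2 (pow_lt_pow_left₀ hy (norm_nonneg _) two_ne_zero)
    positivity
  have hI : 0 < ∫ y in ball (0 : Esp n) s, (s ^ 2 - ‖y‖ ^ 2) / s * d * f y := by
    rw [setIntegral_eq_integral_of_forall_compl_eq_zero]
    · refine hcw.integral_pos_of_hasCompactSupport_nonneg_nonzero ?_ (fun y => ?_) (x := x₀)
        (mul_pos (hpos x₀ hx₀s) hx₀).ne'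
      · refine HasCompactSupport.intro (isCompact_closedBall (0 : Esp n) s) fun y hy => ?_
        rw [mem_closedBall_zero_iff, not_le] at hy
        rw [hf.2 y hy.le, mul_zero]
      · rcases lt_or_ge ‖y‖ s with hy | hy
        · exact mul_nonneg (hpos y hy).le (hf0 y)
        · simp [hf.2 y hy]
    · intro y hy
      rw [mem_ball_zero_iff, not_lt] at hy
      rw [hf.2 y hy, mul_zero]
  refine ⟨_, mul_pos hc hI, fun x hx => ?_⟩
  rw [greenOp_of_lt hx, mul_assoc]
  refine mul_le_mul_of_nonneg_left ?_ hc.le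
  rw [mul_comm, ← integral_const_mul]
  refine integral_mono_ae ((integrableOn_ball_of_continuousOn hcw.continuousOn).const_mul _)
    (integrableOn_greenKer_mul hn hs hγ hf hx) ?_
  filter_upwards [ae_restrict_mem measurableSet_ball, ae_sub_ne_zero_restrict hn x _] with y hy hxy
  rw [← mul_assoc]
  exact mul_le_mul_of_nonneg_right (le_greenKer hs hx (mem_ball_zero_iff.1 hy).le hxy) (hf0 y)

end GreenOperator

section KreinRutman

open Filter Topology

variable {n : ℕ} {s γ : ℝ}

lemma exists_subseq_uniform_limit {u : ℕ → Esp n → ℝ} {L B : ℝ}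
    (hL : ∀ k x y, |u k x - u k y| ≤ L * ‖x - y‖) (h0 : ∀ k x, s ≤ ‖x‖ → u k x = 0)
    (hB : ∀ k x, |u k x| ≤ B) :
    ∃ (g : Esp n → ℝ) (φ : ℕ → ℕ), StrictMono φ ∧ (∀ x, s ≤ ‖x‖ → g x = 0) ∧
      ∀ δ, 0 < δ → ∀ᶠ k in atTop, ∀ x, |u (φ k) x - g x| ≤ δ := by
  have : CompactSpace (closedBall (0 : Esp n) s) :=
    isCompact_iff_compactSpace.1 (isCompact_closedBall _ _)
  have hlip : ∀ k, LipschitzWith L.toNNReal fun x : closedBall (0 : Esp n) s => u k x := fun k =>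
    LipschitzWith.of_dist_le_mul fun x y => by
      rw [Real.dist_eq, Subtype.dist_eq, dist_eq_norm]
      exact (hL k x y).trans
        (mul_le_mul_of_nonneg_right (Real.le_coe_toNNReal _) (norm_nonneg _))
  set U : ℕ → BoundedContinuousFunction (closedBall (0 : Esp n) s) ℝ := fun k =>
    BoundedContinuousFunction.mkOfCompact ⟨_, (hlip k).continuous⟩
  have hc : IsCompact (closure (Set.range U)) := by
    refine BoundedContinuousFunction.arzela_ascoli (Set.Icc (-B) B) isCompact_Icc _ ?_ ?_
    · rintro _ x ⟨k, rfl⟩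
      exact abs_le.1 (hB k x)
    · refine (LipschitzWith.uniformEquicontinuous _ L.toNNReal ?_).equicontinuous
      rintro ⟨_, k, rfl⟩
      exact hlip k
  obtain ⟨G, -, φ, hφ, hG⟩ := hc.tendsto_subseq fun k => subset_closure (Set.mem_range_self k)
  refine ⟨fun x => if h : ‖x‖ < s then G ⟨x, mem_closedBall_zero_iff.2 h.le⟩ else 0, φ, hφ,
    fun x hx => dif_neg hx.not_gt, fun δ hδ => ?_⟩
  rw [tendsto_iff_dist_tendsto_zero] at hG
  filter_upwards [hG.eventually (gt_mem_nhds hδ)] with k hk x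
  by_cases h : ‖x‖ < s
  · rw [dif_pos h]
    exact (BoundedContinuousFunction.dist_coe_le_dist (f := U (φ k)) (g := G)
      ⟨x, mem_closedBall_zero_iff.2 h.le⟩).trans hk.le
  · rw [dif_neg h, h0 _ _ (not_lt.1 h), sub_zero, abs_zero]
    exact hδ.le

lemma IsHolderZero.sub_const_mul {f g : Esp n → ℝ} (hf : IsHolderZero s γ f)
    (hg : IsHolderZero s γ g) (r : ℝ) : IsHolderZero s γ fun x => f x - r * g x := by
  obtain ⟨⟨C, hC0, hC⟩, hfz⟩ := hf
  obtain ⟨⟨D, hD0, hD⟩, hgz⟩ := hg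
  refine ⟨⟨C + |r| * D, by positivity, fun x y => ?_⟩, fun x hx => ?_⟩
  · have h1 : f x - r * g x - (f y - r * g y) = (f x - f y) - r * (g x - g y) := by ring
    rw [h1, add_mul, mul_assoc]
    refine (abs_sub _ _).trans (add_le_add (hC x y) ?_)
    rw [abs_mul]
    exact mul_le_mul_of_nonneg_left (hD x y) (abs_nonneg r)
  · simp only [hfz x hx, hgz x hx, mul_zero, sub_zero]

lemma isHolderZero_zero : IsHolderZero (n := n) s γ fun _ => 0 :=
  ⟨⟨0, le_rfl, by simp⟩, fun _ _ => rfl⟩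

lemma IsHolderZero.exists_max (hγ : 0 < γ) {f : Esp n → ℝ} (hf : IsHolderZero s γ f) {x₀ : Esp n}
    (hx₀ : 0 < f x₀) : ∃ x₁, 0 < f x₁ ∧ ∀ x, f x ≤ f x₁ := by
  have hx₀s : x₀ ∈ closedBall (0 : Esp n) s := by
    by_contra h
    rw [mem_closedBall_zero_iff, not_le] at h
    exact hx₀.ne' (hf.2 x₀ h.le)
  obtain ⟨x₁, -, hmax⟩ := (isCompact_closedBall (0 : Esp n) s).exists_isMaxOn ⟨x₀, hx₀s⟩
    (hf.continuous hγ).continuousOn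
  have h1 : 0 < f x₁ := hx₀.trans_le (hmax hx₀s)
  refine ⟨x₁, h1, fun x => ?_⟩
  rcases le_total ‖x‖ s with hx | hx
  · exact hmax (mem_closedBall_zero_iff.2 hx)
  · rw [hf.2 x hx]
    exact h1.le

/-- A linear operator on Hölder functions in the ball of radius `s` that maps `L^∞` to Lipschitz
functions vanishing at the boundary and obeys the Hopf lemma. -/
structure IsHopfOperator (s γ : ℝ) (K : (Esp n → ℝ) → Esp n → ℝ) : Prop where
  map_sub_const_mul : ∀ f g, IsHolderZero s γ f → IsHolderZero s γ g → ∀ r : ℝ,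
    K (fun x => f x - r * g x) = fun x => K f x - r * K g x
  isHolderZero : ∀ f, IsHolderZero s γ f → IsHolderZero s γ (K f)
  lipschitz : ∃ A, 0 ≤ A ∧ ∀ f M, IsHolderZero s γ f → (∀ x, |f x| ≤ M) →
    ∀ x y, |K f x - K f y| ≤ A * M * ‖x - y‖
  hopf : ∀ f, IsHolderZero s γ f → (∀ x, 0 ≤ f x) → (∃ x, 0 < f x) →
    ∃ c, 0 < c ∧ ∀ x, ‖x‖ < s → c * (s - ‖x‖) ≤ K f x

lemma abs_le_of_lipschitz_of_zero (hn : 1 ≤ n) (hs : 0 < s) {u : Esp n → ℝ} {L : ℝ}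
    (hL : ∀ x y, |u x - u y| ≤ L * ‖x - y‖) (h0 : ∀ x, s ≤ ‖x‖ → u x = 0) {x : Esp n}
    (hx : ‖x‖ ≤ s) : |u x| ≤ L * (s - ‖x‖) := by
  have := abs_le_of_isHolder hn hs (γ := 1) (by simpa using hL) h0 hx
  rwa [Real.rpow_one] at this

lemma abs_le_mul_of_lipschitz_of_zero (hn : 1 ≤ n) (hs : 0 < s) {u : Esp n → ℝ} {L : ℝ}
    (hL0 : 0 ≤ L) (hL : ∀ x y, |u x - u y| ≤ L * ‖x - y‖) (h0 : ∀ x, s ≤ ‖x‖ → u x = 0)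
    (x : Esp n) : |u x| ≤ L * s := by
  rcases le_total ‖x‖ s with hx | hx
  · refine (abs_le_of_lipschitz_of_zero hn hs hL h0 hx).trans ?_
    exact mul_le_mul_of_nonneg_left (by linarith [norm_nonneg x]) hL0
  · rw [h0 x hx, abs_zero]
    positivity

namespace IsHopfOperator

variable {K : (Esp n → ℝ) → Esp n → ℝ}

lemma map_zero (h : IsHopfOperator s γ K) : K (fun _ => 0) = fun _ => 0 := by
  have := h.map_sub_const_mul _ _ isHolderZero_zero isHolderZero_zero 1
  simpa using this

lemma map_const_mul (h : IsHopfOperator s γ K) {f : Esp n → ℝ} (hf : IsHolderZero s γ f) (r : ℝ) :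
    K (fun x => r * f x) = fun x => r * K f x := by
  have := h.map_sub_const_mul _ _ isHolderZero_zero hf (-r)
  simpa [h.map_zero] using this

lemma nonneg (h : IsHopfOperator s γ K) {f : Esp n → ℝ} (hf : IsHolderZero s γ f)
    (hf0 : ∀ x, 0 ≤ f x) (x : Esp n) : 0 ≤ K f x := by
  by_cases hp : ∃ x, 0 < f x
  · obtain ⟨c, hc, hcx⟩ := h.hopf f hf hf0 hp
    rcases lt_or_ge ‖x‖ s with hx | hx
    · exact le_trans (mul_nonneg hc.le (by linarith)) (hcx x hx)
    · exact ((h.isHolderZero f hf).2 x hx).ge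
  · push Not at hp
    have : f = fun _ => 0 := funext fun x => le_antisymm (hp x) (hf0 x)
    rw [this, h.map_zero]

lemma exists_bound (h : IsHopfOperator s γ K) (hn : 1 ≤ n) (hs : 0 < s) :
    ∃ A, 0 ≤ A ∧ ∀ f M, IsHolderZero s γ f → (∀ x, |f x| ≤ M) → ∀ x, |K f x| ≤ A * M := by
  obtain ⟨A, hA0, hA⟩ := h.lipschitz
  refine ⟨A * s, by positivity, fun f M hf hM x => ?_⟩
  have hM0 : 0 ≤ M := (abs_nonneg _).trans (hM 0)
  have := abs_le_mul_of_lipschitz_of_zero hn hs (by positivity) (hA f M hf hM)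
    (h.isHolderZero f hf).2 x
  linarith

/-- The Collatz–Wielandt set of a positive operator. -/
def cwSet (s γ : ℝ) (K : (Esp n → ℝ) → Esp n → ℝ) : Set ℝ :=
  {t | ∃ f, IsHolderZero s γ f ∧ (∀ x, 0 ≤ f x) ∧ (∃ x, 0 < f x) ∧ ∀ x, t * f x ≤ K f x}

lemma bddAbove_cwSet (h : IsHopfOperator s γ K) (hn : 1 ≤ n) (hs : 0 < s) (hγ : 0 < γ) :
    BddAbove (cwSet s γ K) := by
  obtain ⟨A, hA0, hA⟩ := h.exists_bound hn hs
  refine ⟨A, ?_⟩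
  rintro t ⟨f, hf, hf0, ⟨x₀, hx₀⟩, ht⟩
  obtain ⟨x₁, hx₁, hmax⟩ := hf.exists_max hγ hx₀
  have h1 := hA f (f x₁) hf (fun x => by rw [abs_of_nonneg (hf0 x)]; exact hmax x) x₁
  exact le_of_mul_le_mul_right ((ht x₁).trans ((le_abs_self _).trans h1)) hx₁

lemma exists_pos_mem_cwSet (h : IsHopfOperator s γ K) (hn : 1 ≤ n) (hs : 0 < s) (hγ : 0 < γ)
    (hγ1 : γ < 1) : ∃ t ∈ cwSet s γ K, 0 < t := by
  set f : Esp n → ℝ := fun x => max (s - ‖x‖) 0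
  have hfz : ∀ x, s ≤ ‖x‖ → f x = 0 := fun x hx => max_eq_right (by linarith)
  have hf : IsHolderZero s γ f := by
    refine isHolderZero_of_lipschitz hn hs hγ hγ1 zero_le_one (fun x y => ?_) hfz
    rw [one_mul]
    refine (abs_max_sub_max_le_abs _ _ _).trans ?_
    rw [sub_sub_sub_cancel_left, norm_sub_rev]
    exact abs_norm_sub_norm_le _ _
  have hf0 : ∀ x, 0 ≤ f x := fun x => le_max_right _ _
  have hfp : ∃ x, 0 < f x := ⟨0, by simp [f, hs]⟩
  obtain ⟨c, hc, hcx⟩ := h.hopf f hf hf0 hfp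
  refine ⟨c, ⟨f, hf, hf0, hfp, fun x => ?_⟩, hc⟩
  rcases lt_or_ge ‖x‖ s with hx | hx
  · rw [show f x = s - ‖x‖ from max_eq_left (by linarith)]
    exact hcx x hx
  · rw [hfz x hx, mul_zero]
    exact h.nonneg hf hf0 x

lemma exists_normalized (h : IsHopfOperator s γ K) (hγ : 0 < γ) {t : ℝ} (ht : t ∈ cwSet s γ K) :
    ∃ f, IsHolderZero s γ f ∧ (∀ x, 0 ≤ f x) ∧ (∀ x, |f x| ≤ 1) ∧ (∃ x, f x = 1) ∧
      ∀ x, t * f x ≤ K f x := by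
  obtain ⟨f, hf, hf0, ⟨x₀, hx₀⟩, ht⟩ := ht
  obtain ⟨x₁, hx₁, hmax⟩ := hf.exists_max hγ hx₀
  refine ⟨fun x => (f x₁)⁻¹ * f x, ?_, fun x => mul_nonneg (inv_nonneg.2 hx₁.le) (hf0 x),
    fun x => ?_, ⟨x₁, inv_mul_cancel₀ hx₁.ne'⟩, fun x => ?_⟩
  · simpa using isHolderZero_zero.sub_const_mul hf (-(f x₁)⁻¹)
  · rw [abs_of_nonneg (mul_nonneg (inv_nonneg.2 hx₁.le) (hf0 x)), inv_mul_le_one₀ hx₁]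
    exact hmax x
  · rw [h.map_const_mul hf, mul_left_comm]
    exact mul_le_mul_of_nonneg_left (ht x) (inv_nonneg.2 hx₁.le)

/-- The supremum of the Collatz–Wielandt set is attained. -/
lemma exists_maximizer (h : IsHopfOperator s γ K) (hn : 1 ≤ n) (hs : 0 < s) (hγ : 0 < γ)
    (hγ1 : γ < 1) (hr : 0 < sSup (cwSet s γ K)) : sSup (cwSet s γ K) ∈ cwSet s γ K := by
  obtain ⟨t₀, ht₀, -⟩ := h.exists_pos_mem_cwSet hn hs hγ hγ1
  obtain ⟨t, -, htr, htS⟩ := exists_seq_tendsto_sSup ⟨t₀, ht₀⟩ (h.bddAbove_cwSet hn hs hγ)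
  set r := sSup (cwSet s γ K)
  choose f hf hf0 hf1 hfx hft using fun k => h.exists_normalized hγ (htS k)
  obtain ⟨A, hA0, hA⟩ := h.lipschitz
  obtain ⟨B, hB0, hB⟩ := h.exists_bound hn hs
  have hL := fun k => hA (f k) 1 (hf k) (hf1 k)
  have hKf := fun k => h.isHolderZero (f k) (hf k)
  obtain ⟨g, φ, hφ, hg0, hlim⟩ := exists_subseq_uniform_limit (u := fun k => K (f k)) hL
    (fun k => (hKf k).2) (fun k => hB (f k) 1 (hf k) (hf1 k))
  have htφ : Tendsto (fun k => t (φ k)) atTop (𝓝 r) := htr.comp hφ.tendsto_atTop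
  have hpt : ∀ x, Tendsto (fun k => K (f (φ k)) x) atTop (𝓝 (g x)) := by
    intro x
    rw [Metric.tendsto_nhds]
    intro δ hδ
    filter_upwards [hlim (δ / 2) (by positivity)] with k hk
    rw [Real.dist_eq]
    linarith [hk x]
  have hgL : ∀ x y, |g x - g y| ≤ A * 1 * ‖x - y‖ := fun x y =>
    le_of_tendsto ((hpt x).sub (hpt y)).abs (Filter.Eventually.of_forall fun k => hL (φ k) x y)
  have hg : IsHolderZero s γ g :=
    isHolderZero_of_lipschitz hn hs hγ hγ1 (by positivity) hgL hg0
  have hKpt : ∀ x, Tendsto (fun k => K (K (f (φ k))) x) atTop (𝓝 (K g x)) := by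
    intro x
    rw [Metric.tendsto_nhds]
    intro δ hδ
    have hδ' : 0 < δ / (B + 1) := by positivity
    filter_upwards [hlim _ hδ'] with k hk
    have h1 := hB _ _ ((hKf (φ k)).sub_const_mul hg 1) (by simpa only [one_mul] using hk) x
    rw [h.map_sub_const_mul _ _ (hKf (φ k)) hg] at h1
    simp only [one_mul] at h1
    rw [Real.dist_eq]
    refine h1.trans_lt ?_
    rw [mul_div_assoc', div_lt_iff₀ (by positivity)]
    nlinarith
  have hev : ∀ᶠ k in atTop, r / 2 < t (φ k) := htφ.eventually (lt_mem_nhds (by linarith))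
  have hge : ∀ᶠ k in atTop, ∀ x, 0 ≤ K (f (φ k)) x - t (φ k) * f (φ k) x :=
    Filter.Eventually.of_forall fun k x => sub_nonneg.2 (hft (φ k) x)
  have hineq : ∀ x, r * g x ≤ K g x := fun x => by
    refine le_of_tendsto_of_tendsto (htφ.mul (hpt x)) (hKpt x) ?_
    filter_upwards [hge] with k hk
    have := h.nonneg ((hKf (φ k)).sub_const_mul (hf (φ k)) (t (φ k))) hk x
    rw [h.map_sub_const_mul _ _ (hKf (φ k)) (hf (φ k))] at this
    linarith
  refine ⟨g, hg, fun x => ge_of_tendsto' (hpt x) fun k => h.nonneg (hf _) (hf0 _) x, ?_, hineq⟩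
  obtain ⟨k, hk, hkg⟩ := (hev.and (hlim (r / 4) (by positivity))).exists
  obtain ⟨x, hx⟩ := hfx (φ k)
  have h1 := hft (φ k) x
  rw [hx, mul_one] at h1
  exact ⟨x, by linarith [(abs_le.1 (hkg x)).2]⟩

/-- A Krein–Rutman theorem: existence of a positive eigenfunction with positive eigenvalue. -/
lemma exists_eigenfunction (h : IsHopfOperator s γ K) (hn : 1 ≤ n) (hs : 0 < s) (hγ : 0 < γ)
    (hγ1 : γ < 1) :
    ∃ r, 0 < r ∧ ∃ g, IsHolderZero s γ g ∧ (∀ x, 0 ≤ g x) ∧ (∃ x, 0 < g x) ∧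
      ∀ x, K g x = r * g x := by
  obtain ⟨t, ht, ht0⟩ := h.exists_pos_mem_cwSet hn hs hγ hγ1
  have hbdd := h.bddAbove_cwSet hn hs hγ
  have hr := ht0.trans_le (le_csSup hbdd ht)
  obtain ⟨g, hg, hg0, ⟨x₀, hx₀⟩, hrg⟩ := h.exists_maximizer hn hs hγ hγ1 hr
  refine ⟨_, hr, g, hg, hg0, ⟨x₀, hx₀⟩, ?_⟩
  set r := sSup (cwSet s γ K)
  by_contra! hne
  obtain ⟨x₁, hx₁⟩ := hne
  have hKg := h.isHolderZero g hg
  have hw := hKg.sub_const_mul hg r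
  obtain ⟨c, hc, hcx⟩ := h.hopf _ hw (fun x => sub_nonneg.2 (hrg x))
    ⟨x₁, sub_pos.2 (lt_of_le_of_ne (hrg x₁) hx₁.symm)⟩
  rw [h.map_sub_const_mul _ _ hKg hg] at hcx
  obtain ⟨M, hM⟩ := hg.bounded hγ
  obtain ⟨A, hA0, hA⟩ := h.lipschitz
  have hM0 : 0 ≤ M := (abs_nonneg _).trans (hM 0)
  have hL : 0 < A * M + 1 := by positivity
  have hmem : r + c / (A * M + 1) ∈ cwSet s γ K := by
    refine ⟨K g, hKg, h.nonneg hg hg0, ⟨x₀, (mul_pos hr hx₀).trans_le (hrg x₀)⟩, fun x => ?_⟩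
    rcases lt_or_ge ‖x‖ s with hx | hx
    · have h1 := (le_abs_self _).trans
        (abs_le_of_lipschitz_of_zero hn hs (hA g M hg hM) hKg.2 hx.le)
      have h2 : c / (A * M + 1) * K g x ≤ c * (s - ‖x‖) := by
        rw [div_mul_eq_mul_div, div_le_iff₀ hL, mul_assoc]
        refine mul_le_mul_of_nonneg_left ?_ hc.le
        nlinarith
      have h3 := hcx x hx
      rw [add_mul]
      linarith
    · rw [hKg.2 x hx, mul_zero, (h.isHolderZero _ hKg).2 x hx]
  have := le_csSup hbdd hmem
  have : 0 < c / (A * M + 1) := div_pos hc hL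
  linarith

end IsHopfOperator

end KreinRutman

section Navier

variable {n : ℕ} {s γ : ℝ}

lemma IsHolderZero.mul_weight (hγ : 0 < γ) {ρ : Esp n → ℝ} {B C : ℝ}
    (hB : ∀ x, ‖x‖ ≤ s → |ρ x| ≤ B) (hC0 : 0 ≤ C)
    (hC : ∀ x y, ‖x‖ ≤ s → ‖y‖ ≤ s → |ρ x - ρ y| ≤ C * ‖x - y‖ ^ γ) {f : Esp n → ℝ}
    (hf : IsHolderZero s γ f) : IsHolderZero s γ fun x => ρ x * f x := by
  obtain ⟨M, hM⟩ := hf.bounded hγ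
  obtain ⟨⟨D, hD0, hD⟩, hz⟩ := hf
  have hM0 : 0 ≤ M := (abs_nonneg _).trans (hM 0)
  have key : ∀ x y, ‖x‖ ≤ s → |ρ x * f x - ρ y * f y| ≤ (|B| * D + C * M) * ‖x - y‖ ^ γ := by
    intro x y hx
    have hp : 0 ≤ ‖x - y‖ ^ γ := by positivity
    have h1 : |ρ x| * |f x - f y| ≤ |B| * (D * ‖x - y‖ ^ γ) :=
      mul_le_mul ((hB x hx).trans (le_abs_self B)) (hD x y) (abs_nonneg _) (abs_nonneg _)
    have h2 : |ρ x - ρ y| * |f y| ≤ C * ‖x - y‖ ^ γ * M := by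
      rcases le_total ‖y‖ s with hy | hy
      · exact mul_le_mul (hC x y hx hy) (hM y) (abs_nonneg _) (by positivity)
      · rw [hz y hy, abs_zero, mul_zero]
        positivity
    have h3 : ρ x * f x - ρ y * f y = ρ x * (f x - f y) + (ρ x - ρ y) * f y := by ring
    rw [h3]
    refine (abs_add_le _ _).trans ?_
    rw [abs_mul, abs_mul]
    linarith
  refine ⟨⟨|B| * D + C * M, by positivity, fun x y => ?_⟩, fun x hx => ?_⟩
  · rcases le_total ‖x‖ s with hx | hx
    · exact key x y hx
    · rcases le_total ‖y‖ s with hy | hy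
      · rw [abs_sub_comm, norm_sub_rev]
        exact key y x hy
      · simp only [hz x hx, hz y hy, mul_zero, sub_zero, abs_zero]
        positivity
  · simp only [hz x hx, mul_zero]

lemma isHopfOperator_greenOp (hn : 1 ≤ n) (hs : 0 < s) (hγ : 0 < γ) (hγ1 : γ < 1) :
    IsHopfOperator (n := n) s γ (greenOp s) where
  map_sub_const_mul _ _ hf hg r := greenOp_sub_const_mul hn hs hγ hf hg r
  isHolderZero _ hf := isHolderZero_greenOp hn hs hγ hγ1 hf
  lipschitz := ⟨greenLip n s, greenLip_nonneg n s,
    fun _ _ hf hM => greenOp_lipschitz hn hs hγ hf hM⟩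
  hopf _ hf hf0 hx := exists_le_greenOp hn hs hγ hf hf0 hx.choose_spec

lemma IsHopfOperator.comp_weight {K : (Esp n → ℝ) → Esp n → ℝ} (h : IsHopfOperator s γ K)
    (hγ : 0 < γ) {ρ : Esp n → ℝ} {B C : ℝ} (hρ : ∀ x, ‖x‖ ≤ s → 0 < ρ x)
    (hB : ∀ x, ‖x‖ ≤ s → |ρ x| ≤ B) (hC0 : 0 ≤ C)
    (hC : ∀ x y, ‖x‖ ≤ s → ‖y‖ ≤ s → |ρ x - ρ y| ≤ C * ‖x - y‖ ^ γ) :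
    IsHopfOperator s γ fun f => K fun x => ρ x * f x where
  map_sub_const_mul f g hf hg r := by
    rw [← h.map_sub_const_mul _ _ (hf.mul_weight hγ hB hC0 hC) (hg.mul_weight hγ hB hC0 hC) r]
    congr 1
    ext x
    ring
  isHolderZero f hf := h.isHolderZero _ (hf.mul_weight hγ hB hC0 hC)
  lipschitz := by
    obtain ⟨A, hA0, hA⟩ := h.lipschitz
    refine ⟨A * |B|, by positivity, fun f M hf hM x y => ?_⟩
    have hM0 : 0 ≤ M := (abs_nonneg _).trans (hM 0)
    rw [mul_assoc A]
    refine hA _ _ (hf.mul_weight hγ hB hC0 hC) (fun z => ?_) x y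
    rw [abs_mul]
    rcases le_total ‖z‖ s with hz | hz
    · exact mul_le_mul ((hB z hz).trans (le_abs_self B)) (hM z) (abs_nonneg _) (abs_nonneg _)
    · rw [hf.2 z hz, abs_zero, mul_zero]
      positivity
  hopf f hf hf0 := by
    rintro ⟨x₀, hx₀⟩
    have hz := (hf.mul_weight hγ hB hC0 hC).2
    refine h.hopf _ (hf.mul_weight hγ hB hC0 hC) (fun x => ?_) ⟨x₀, mul_pos (hρ x₀ ?_) hx₀⟩
    · rcases le_total ‖x‖ s with hx | hx
      · exact mul_nonneg (hρ x hx).le (hf0 x)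
      · exact (hz x hx).ge
    · by_contra hx
      exact hx₀.ne' (hf.2 x₀ (not_le.1 hx).le)

lemma IsHopfOperator.exists_pos (hs : 0 < s) {K : (Esp n → ℝ) → Esp n → ℝ}
    (h : IsHopfOperator s γ K) {f : Esp n → ℝ} (hf : IsHolderZero s γ f) (hf0 : ∀ x, 0 ≤ f x)
    (hfp : ∃ x, 0 < f x) : ∃ x, 0 < K f x := by
  obtain ⟨c, hc, hcx⟩ := h.hopf f hf hf0 hfp
  refine ⟨0, lt_of_lt_of_le ?_ (hcx 0 (by simpa using hs))⟩
  simpa using mul_pos hc hs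

lemma IsHopfOperator.comp {K T : (Esp n → ℝ) → Esp n → ℝ} (hT : IsHopfOperator s γ T)
    (hK : IsHopfOperator s γ K) (hn : 1 ≤ n) (hs : 0 < s) :
    IsHopfOperator s γ fun f => T (K f) where
  map_sub_const_mul f g hf hg r := by
    rw [hK.map_sub_const_mul _ _ hf hg, hT.map_sub_const_mul _ _ (hK.isHolderZero f hf)
      (hK.isHolderZero g hg)]
  isHolderZero f hf := hT.isHolderZero _ (hK.isHolderZero f hf)
  lipschitz := by
    obtain ⟨A, hA0, hA⟩ := hT.lipschitz
    obtain ⟨B, hB0, hB⟩ := hK.exists_bound hn hs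
    refine ⟨A * B, by positivity, fun f M hf hM x y => ?_⟩
    rw [mul_assoc A]
    exact hA _ _ (hK.isHolderZero f hf) (hB f M hf hM) x y
  hopf f hf hf0 hfp := hT.hopf _ (hK.isHolderZero f hf) (hK.nonneg hf hf0)
    (hK.exists_pos hs hf hf0 hfp)

/-- The solution operator of `(-Δ)^(k+1) u = ρ f` in the ball of radius `s` with Navier boundary
conditions. -/
def navierOp (s : ℝ) (ρ : Esp n → ℝ) : ℕ → (Esp n → ℝ) → Esp n → ℝ
  | 0, f => greenOp s fun x => ρ x * f x
  | k + 1, f => greenOp s (navierOp s ρ k f)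

lemma isHopfOperator_navierOp (hn : 1 ≤ n) (hs : 0 < s) (hγ : 0 < γ) (hγ1 : γ < 1)
    {ρ : Esp n → ℝ} {B C : ℝ} (hρ : ∀ x, ‖x‖ ≤ s → 0 < ρ x)
    (hB : ∀ x, ‖x‖ ≤ s → |ρ x| ≤ B) (hC0 : 0 ≤ C)
    (hC : ∀ x y, ‖x‖ ≤ s → ‖y‖ ≤ s → |ρ x - ρ y| ≤ C * ‖x - y‖ ^ γ) :
    ∀ k, IsHopfOperator s γ (navierOp s ρ k)
  | 0 => (isHopfOperator_greenOp hn hs hγ hγ1).comp_weight hγ hρ hB hC0 hC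
  | k + 1 => (isHopfOperator_greenOp hn hs hγ hγ1).comp
      (isHopfOperator_navierOp hn hs hγ hγ1 hρ hB hC0 hC k) hn hs

lemma navierOp_of_le {ρ f : Esp n → ℝ} {x : Esp n} (hx : s ≤ ‖x‖) :
    ∀ k, navierOp s ρ k f x = 0
  | 0 => greenOp_of_le hx _
  | _ + 1 => greenOp_of_le hx _

end Navier

/-- Theorem 1.6, existence for the Navier poly-Laplacian problem on a
ball, Hölder continuous weight: there exist a positive principal eigenvalue and a
principal eigenfunction `(v₀,…,v_{m-1})`, all of whose components are positive in `B_s`. -/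
theorem stmt10 {n : ℕ} (hn : 1 ≤ n) (m : ℕ) [NeZero m] (hm : 1 ≤ m)
    (s : ℝ) (hs : 0 < s) (γ : ℝ) (hγ0 : 0 < γ) (hγ1 : γ < 1)
    (ρ : Esp n → ℝ)
    (hρpos : ∀ x ∈ closure (ball (0 : Esp n) s), 0 < ρ x)
    (hρbdd : ∃ Kb : ℝ, ∀ x ∈ closure (ball (0 : Esp n) s), |ρ x| ≤ Kb)
    (hρhold : ∃ Ch : ℝ, 0 < Ch ∧ ∀ x ∈ closure (ball (0 : Esp n) s),
      ∀ y ∈ closure (ball (0 : Esp n) s), |ρ x - ρ y| ≤ Ch * ‖x - y‖ ^ γ) :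
    ∃ lam : ℝ, 0 < lam ∧ IsNavierPrincipalEV m (ball (0 : Esp n) s) ρ lam := by
  simp only [closure_ball (0 : Esp n) hs.ne', mem_closedBall_zero_iff] at hρpos hρbdd hρhold
  obtain ⟨B, hB⟩ := hρbdd
  obtain ⟨C, hC0, hC⟩ := hρhold
  have hC' : ∀ x y : Esp n, ‖x‖ ≤ s → ‖y‖ ≤ s → |ρ x - ρ y| ≤ C * ‖x - y‖ ^ γ :=
    fun x y hx hy => hC x hx y hy
  have hK := isHopfOperator_navierOp hn hs hγ0 hγ1 hρpos hB hC0.le hC'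
  obtain ⟨r, hr, g, hg, hg0, ⟨x₀, hx₀⟩, hrg⟩ := (hK (m - 1)).exists_eigenfunction hn hs hγ0 hγ1
  set f : Esp n → ℝ := fun x => r⁻¹ * g x with hfdef
  have hf : IsHolderZero s γ f := by
    simpa using isHolderZero_zero.sub_const_mul hg (-r⁻¹)
  have hf0 : ∀ x, 0 ≤ f x := fun x => mul_nonneg (inv_nonneg.2 hr.le) (hg0 x)
  have hfp : ∃ x, 0 < f x := ⟨x₀, mul_pos (inv_pos.2 hr) hx₀⟩
  have hρf := hf.mul_weight hγ0 hB hC0.le hC'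
  have hreg : ∀ k, Regular (ball 0 s) (navierOp s ρ k f)
    | 0 => regular_greenOp hn hs hγ0 hγ1 hρf
    | k + 1 => regular_greenOp hn hs hγ0 hγ1 ((hK k).isHolderZero f hf)
  have htop : navierOp s ρ (m - 1) f = g := by
    rw [hfdef, (hK (m - 1)).map_const_mul hg]
    ext x
    rw [hrg, inv_mul_cancel_left₀ hr.ne']
  refine ⟨r⁻¹, inv_pos.2 hr, fun j => navierOp s ρ (m - 1 - j) f, fun j => hreg _,
    fun j x hx => ?_, fun j x hx => ?_, fun j hj x hx => ?_, fun j hj => ?_⟩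
  · rw [frontier_ball _ hs.ne', mem_sphere_zero_iff_norm] at hx
    exact navierOp_of_le hx.ge _
  · rw [mem_ball_zero_iff] at hx
    obtain ⟨c, hc, hcx⟩ := (hK (m - 1 - j)).hopf f hf hf0 hfp
    exact (mul_pos hc (sub_pos.2 hx)).trans_le (hcx x hx)
  · have h1 : ((j + 1 : Fin m) : ℕ) = j + 1 := by
      rw [Fin.val_add, Fin.val_one', Nat.add_mod_mod, Nat.mod_eq_of_lt hj]
    simp only [h1]
    obtain ⟨k, hk⟩ : ∃ k, m - 1 - (j : ℕ) = k + 1 := ⟨m - 2 - j, by omega⟩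
    rw [hk, show m - 1 - ((j : ℕ) + 1) = k by omega]
    exact neg_lapl_greenOp hn hs hγ0 ((hK k).isHolderZero f hf) hx
  · refine (ae_restrict_iff' measurableSet_ball).2 (Filter.Eventually.of_forall fun x hx => ?_)
    simp only [Fin.val_zero, Nat.sub_zero, htop]
    rw [show m - 1 - (j : ℕ) = 0 by omega]
    refine (neg_lapl_greenOp hn hs hγ0 hρf hx).trans ?_
    simp only [hfdef]
    ring

end
end
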